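/- Let ρ > 0. For every ε > 0 there exists δ > 0 such that: whenever q is a C⁸ function on the closed ball {x ∈ ℝ³ : |x| ≤ ρ} with C⁸ norm at most δ, the unique C² solution u on the double conical region D_ρ = {(x,t) : |x| ≤ ρ, |x| ≤ t ≤ 2ρ − |x|} of the Goursat problem ∂_t²u − Δu − q·u = 0 in the interior of D_ρ, u(x,|x|) = ∫₀¹ q(σx) dσ, satisfies ‖u‖_{C²(D_ρ)} ≤ ε. -/

import Mathlib

noncomputable section

open Real MeasureTheory Metric Set

/-- Euclidean 3-space. -/
abbrev E3 : Type := EuclideanSpace ℝ (Fin 3)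

/-- The `i`-th standard basis vector of `ℝ³`. -/
def basis3 (i : Fin 3) : E3 := EuclideanSpace.single i 1

/-- The partial derivative `∂ᵢ f` of a function on `ℝ³`. -/
def pd (i : Fin 3) (f : E3 → ℝ) (x : E3) : ℝ := fderiv ℝ f x (basis3 i)

/-- The Laplacian `Δf` on `ℝ³`. -/
def lap (f : E3 → ℝ) (x : E3) : ℝ := ∑ i, pd i (pd i f) x

/-- The radial derivative `∂_r f(x) = (x/|x|)·∇f(x)`. -/
def pdr (f : E3 → ℝ) (x : E3) : ℝ := ‖x‖⁻¹ * ∑ i, x i * pd i f x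

/-- The angular derivative `Ω_{ij} f = xᵢ ∂ⱼ f − xⱼ ∂ᵢ f`. -/
def ang (i j : Fin 3) (f : E3 → ℝ) (x : E3) : ℝ := x i * pd j f x - x j * pd i f x

/-- `Ω f = Σ_{i<j} Ω_{ij}(Ω_{ij} f)`. -/
def angLap (f : E3 → ℝ) (x : E3) : ℝ :=
  ∑ i, ∑ j, if i < j then ang i j (ang i j f) x else 0

/-- The squared length `|∇f(x)|²` of the gradient. -/
def gradsq (f : E3 → ℝ) (x : E3) : ℝ := ∑ i, (pd i f x) ^ 2

/-- `Σ_{i<j} (Ω_{ij} g)²`. -/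
def angsq (g : E3 → ℝ) (x : E3) : ℝ := ∑ i, ∑ j, if i < j then (ang i j g x) ^ 2 else 0

/-- `Σ_{i<j} Σ_{k<l} (Ω_{kl} Ω_{ij} g)²`. -/
def angsq2 (g : E3 → ℝ) (x : E3) : ℝ :=
  ∑ i, ∑ j, ∑ k, ∑ l, if i < j ∧ k < l then (ang k l (ang i j g) x) ^ 2 else 0

/-- The time derivative `∂_t u` of a space-time function. -/
def pdt (u : E3 × ℝ → ℝ) (p : E3 × ℝ) : ℝ := fderiv ℝ u p (0, 1)

/-- The spatial slice `x ↦ u(x,t)` of a space-time function, at fixed time `t`. -/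
def fixT (u : E3 × ℝ → ℝ) (t : ℝ) : E3 → ℝ := fun y => u (y, t)

/-- The spatial partial derivative `∂ᵢ u` of a space-time function (`t` fixed). -/
def pdx (i : Fin 3) (u : E3 × ℝ → ℝ) (p : E3 × ℝ) : ℝ := pd i (fixT u p.2) p.1

/-- The spatial radial derivative `∂_r u` of a space-time function (`t` fixed). -/
def pdrX (u : E3 × ℝ → ℝ) (p : E3 × ℝ) : ℝ := pdr (fixT u p.2) p.1

/-- The spatial angular derivative `Ω_{ij} u` of a space-time function (`t` fixed). -/
def angX (i j : Fin 3) (u : E3 × ℝ → ℝ) (p : E3 × ℝ) : ℝ := ang i j (fixT u p.2) p.1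

/-- The spatial operator `Ω u` of a space-time function (`t` fixed). -/
def angLapX (u : E3 × ℝ → ℝ) (p : E3 × ℝ) : ℝ := angLap (fixT u p.2) p.1

/-- The spatial Laplacian `Δu` of a space-time function (`t` fixed). -/
def lapX (u : E3 × ℝ → ℝ) (p : E3 × ℝ) : ℝ := lap (fixT u p.2) p.1

/-- The squared spatial gradient `|∇u|²` of a space-time function (`t` fixed). -/
def gradsqX (u : E3 × ℝ → ℝ) (p : E3 × ℝ) : ℝ := gradsq (fixT u p.2) p.1

/-- `Σ_{i<j} (Ω_{ij} w)²` for a space-time function (`t` fixed). -/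
def angsqX (w : E3 × ℝ → ℝ) (p : E3 × ℝ) : ℝ :=
  ∑ i, ∑ j, if i < j then (angX i j w p) ^ 2 else 0

/-- The solid light cone `t ≥ |x|`. -/
def cone : Set (E3 × ℝ) := {p | ‖p.1‖ ≤ p.2}

/-- `u` is a C² solution of the Goursat problem for `q` on the cone `t ≥ |x|`:
`∂_t²u − Δu − q u = 0` for `t > |x|` and `u(x,|x|) = ∫₀¹ q(σx) dσ`. -/
def GoursatSol (q : E3 → ℝ) (u : E3 × ℝ → ℝ) : Prop :=
  ContDiffOn ℝ 2 u cone ∧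
  (∀ p : E3 × ℝ, ‖p.1‖ < p.2 → pdt (pdt u) p - lapX u p - q p.1 * u p = 0) ∧
  (∀ x : E3, u (x, ‖x‖) = ∫ σ in (0:ℝ)..1, q (σ • x))

/-- `p(x) = ∫₀^{|x|} q(σ x/|x|) dσ`. -/
def pfun (q : E3 → ℝ) (x : E3) : ℝ := ∫ σ in (0:ℝ)..‖x‖, q ((σ / ‖x‖) • x)

/-- Integral over the sphere of radius `r` with respect to surface measure. -/
def sphInt (r : ℝ) (g : E3 → ℝ) : ℝ := ∫ x in sphere (0:E3) r, g x ∂μH[2]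

/-- Squared `L²` norm on the sphere of radius `r`. -/
def L2sq (g : E3 → ℝ) (r : ℝ) : ℝ := sphInt r (fun x => (g x) ^ 2)

/-- Squared `H¹` norm on the sphere of radius `r`. -/
def H1sq (g : E3 → ℝ) (r : ℝ) : ℝ := sphInt r (fun x => (g x) ^ 2 + (r ^ 2)⁻¹ * angsq g x)

/-- Squared `H²` norm on the sphere of radius `r`. -/
def H2sq (g : E3 → ℝ) (r : ℝ) : ℝ := H1sq g r + sphInt r (fun x => (r ^ 4)⁻¹ * angsq2 g x)

/-- The class `Q_γ(R,T)`. -/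
def memQ (R T γ : ℝ) (q : E3 → ℝ) : Prop :=
  ∀ r ∈ Icc R ((R + T) / 2),
    Real.sqrt (H2sq (pfun q) r) + Real.sqrt (H1sq (pdr (pfun q)) r) ≤
      γ * (Real.sqrt (H1sq (pfun q) r) + Real.sqrt (L2sq (pdr (pfun q)) r))

/-- The closed annulus `R ≤ |x| ≤ ρ` in `ℝ³`. -/
def Ann (R ρ : ℝ) : Set E3 := {x | R ≤ ‖x‖ ∧ ‖x‖ ≤ ρ}

/-- The space-time region `K_ρ = {R ≤ |x| ≤ ρ, |x| ≤ t ≤ R+T−|x|}`. -/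
def Kreg (R T ρ : ℝ) : Set (E3 × ℝ) :=
  {p | R ≤ ‖p.1‖ ∧ ‖p.1‖ ≤ ρ ∧ ‖p.1‖ ≤ p.2 ∧ p.2 ≤ R + T - ‖p.1‖}

/-- `F = ∂_t²w − ∂_r∂_r w − |x|^{-2} Ω w`. -/
def Fop (w : E3 × ℝ → ℝ) (p : E3 × ℝ) : ℝ :=
  pdt (pdt w) p - pdrX (pdrX w) p - (‖p.1‖ ^ 2)⁻¹ * angLapX w p

/-- The sideways energy `J(ρ)`. -/
def Jfun (R T : ℝ) (w : E3 × ℝ → ℝ) (ρ : ℝ) : ℝ :=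
  ∫ t in ρ..(R + T - ρ), sphInt ρ
    (fun x => (ρ ^ 2)⁻¹ * ((w (x, t)) ^ 2 + (pdt w (x, t)) ^ 2 + gradsqX w (x, t)))

/-- The double conical region `D_ρ = {|x| ≤ ρ, |x| ≤ t ≤ 2ρ − |x|}`. -/
def Dcone (ρ : ℝ) : Set (E3 × ℝ) :=
  {p | ‖p.1‖ ≤ ρ ∧ ‖p.1‖ ≤ p.2 ∧ p.2 ≤ 2 * ρ - ‖p.1‖}

/-- `u` is a C² solution of the Goursat problem for `q` on the double conical region `D_ρ`. -/
def IsSolOn (ρ : ℝ) (q : E3 → ℝ) (u : E3 × ℝ → ℝ) : Prop :=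
  ContDiffOn ℝ 2 u (Dcone ρ) ∧
  (∀ p ∈ interior (Dcone ρ), pdt (pdt u) p - lapX u p - q p.1 * u p = 0) ∧
  (∀ x : E3, ‖x‖ ≤ ρ → u (x, ‖x‖) = ∫ σ in (0:ℝ)..1, q (σ • x))

/-- The generator of rotations in the coordinate plane `(i, j)`. -/
def rotGen (i j : Fin 3) : E3 →L[ℝ] E3 :=
  (EuclideanSpace.proj i : E3 →L[ℝ] ℝ).smulRight (basis3 j) -
    (EuclideanSpace.proj j : E3 →L[ℝ] ℝ).smulRight (basis3 i)

lemma rotGen_apply (i j : Fin 3) (y : E3) : rotGen i j y = y i • basis3 j - y j • basis3 i := by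
  simp [rotGen]

/-- Rotation by the angle `θ` in the coordinate plane `(i, j)`, as a linear map. -/
def rotLin (i j : Fin 3) (θ : ℝ) : E3 →ₗ[ℝ] E3 :=
  LinearMap.id + sin θ • (rotGen i j : E3 →ₗ[ℝ] E3) +
    (1 - cos θ) • ((rotGen i j : E3 →ₗ[ℝ] E3) ∘ₗ (rotGen i j : E3 →ₗ[ℝ] E3))

lemma rotLin_apply (i j : Fin 3) (θ : ℝ) (y : E3) :
    rotLin i j θ y = y + sin θ • rotGen i j y + (1 - cos θ) • rotGen i j (rotGen i j y) := by
  simp [rotLin]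

lemma norm_rotLin {i j : Fin 3} (hij : i < j) (θ : ℝ) (y : E3) : ‖rotLin i j θ y‖ = ‖y‖ := by
  have key : ‖rotLin i j θ y‖ ^ 2 = ‖y‖ ^ 2 := by
    have h := sin_sq_add_cos_sq θ
    rw [EuclideanSpace.real_norm_sq_eq, EuclideanSpace.real_norm_sq_eq, rotLin_apply]
    simp only [Fin.sum_univ_three, rotGen_apply, basis3]
    fin_cases i <;> fin_cases j <;> simp at hij ⊢
    · linear_combination ((y 0)^2 + (y 1)^2) * h
    · linear_combination ((y 0)^2 + (y 2)^2) * h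
    · linear_combination ((y 1)^2 + (y 2)^2) * h
  exact (pow_left_inj₀ (norm_nonneg _) (norm_nonneg _) two_ne_zero).1 key

/-- Rotation by the angle `θ` in the coordinate plane `(i, j)`. -/
def rot {i j : Fin 3} (hij : i < j) (θ : ℝ) : E3 ≃ₗᵢ[ℝ] E3 :=
  LinearIsometry.toLinearIsometryEquiv ⟨rotLin i j θ, norm_rotLin hij θ⟩ rfl

lemma rot_apply {i j : Fin 3} (hij : i < j) (θ : ℝ) (y : E3) :
    rot hij θ y = y + sin θ • rotGen i j y + (1 - cos θ) • rotGen i j (rotGen i j y) :=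
  rotLin_apply i j θ y

lemma rotGen_rotGen_rotGen {i j : Fin 3} (hij : i < j) (y : E3) :
    rotGen i j (rotGen i j (rotGen i j y)) = -rotGen i j y := by
  simp only [rotGen_apply, basis3]
  ext k
  fin_cases i <;> fin_cases j <;> simp at hij ⊢ <;> ring

lemma hasDerivAt_rot {i j : Fin 3} (hij : i < j) (θ : ℝ) (y : E3) :
    HasDerivAt (fun θ => rot hij θ y) (rotGen i j (rot hij θ y)) θ := by
  have h : HasDerivAt (fun θ => y + sin θ • rotGen i j y +
      (1 - cos θ) • rotGen i j (rotGen i j y))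
      (cos θ • rotGen i j y + (- - sin θ) • rotGen i j (rotGen i j y)) θ :=
    (((hasDerivAt_sin θ).smul_const _).const_add _).add
      (((hasDerivAt_cos θ).const_sub 1).smul_const _)
  simp only [rot_apply]
  convert h using 1
  simp only [map_add, map_smul, rotGen_rotGen_rotGen hij]
  module

lemma sum_rotGen_rotGen (y : E3) :
    rotGen 0 1 (rotGen 0 1 y) + rotGen 0 2 (rotGen 0 2 y) + rotGen 1 2 (rotGen 1 2 y)
      = (-2 : ℝ) • y := by
  simp only [rotGen_apply, basis3]
  ext k
  fin_cases k <;> simp <;> ring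

/-- There is a rotation invariant probability measure on the unit sphere of `ℝ³`. -/
lemma exists_sphere_measure : ∃ μ : Measure E3, IsProbabilityMeasure μ ∧
    μ (sphere (0 : E3) 1)ᶜ = 0 ∧ ∀ L : E3 ≃ₗᵢ[ℝ] E3, MeasurePreserving L μ μ := by
  have hf : Measurable (fun y : E3 => ‖y‖⁻¹ • y) :=
    (measurable_norm.inv).smul measurable_id
  set ν : Measure E3 := ProbabilityTheory.cond volume (ball (0 : E3) 1) with hν
  have hν1 : IsProbabilityMeasure ν :=
    ProbabilityTheory.cond_isProbabilityMeasure_of_finite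
      (measure_ball_pos _ _ one_pos).ne' measure_ball_lt_top.ne
  refine ⟨ν.map fun y : E3 => ‖y‖⁻¹ • y, Measure.isProbabilityMeasure_map hf.aemeasurable, ?_, ?_⟩
  · rw [Measure.map_apply hf isClosed_sphere.measurableSet.compl]
    refine measure_mono_null (t := {0}) ?_ ?_
    · intro y hy
      by_contra h0
      have h0 : y ≠ 0 := h0
      apply hy
      simp [norm_smul, h0]
    · exact ProbabilityTheory.cond_absolutelyContinuous (measure_singleton (0 : E3))
  · intro L
    have hL : MeasurePreserving L ν ν := by
      refine ⟨L.continuous.measurable, ?_⟩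
      ext s hs
      rw [Measure.map_apply L.continuous.measurable hs, hν,
        ProbabilityTheory.cond_apply measurableSet_ball,
        ProbabilityTheory.cond_apply measurableSet_ball,
        ← L.measurePreserving.measure_preimage (measurableSet_ball.inter hs).nullMeasurableSet]
      congr 2
      rw [preimage_inter]
      congr 1
      ext y
      simp
    refine ⟨L.continuous.measurable, ?_⟩
    rw [Measure.map_map L.continuous.measurable hf]
    have : (L ∘ fun y : E3 => ‖y‖⁻¹ • y) = (fun y : E3 => ‖y‖⁻¹ • y) ∘ L := by
      ext1 y; simp
    rw [this, ← Measure.map_map hf L.continuous.measurable, hL.map_eq]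

/-- A measure with the properties provided by `exists_sphere_measure`. -/
structure IsSphereMeasure (μ : Measure E3) : Prop where
  prob : IsProbabilityMeasure μ
  compl : μ (sphere (0 : E3) 1)ᶜ = 0
  inv : ∀ L : E3 ≃ₗᵢ[ℝ] E3, MeasurePreserving L μ μ

namespace IsSphereMeasure

variable {μ : Measure E3} (hμ : IsSphereMeasure μ)
include hμ

lemma ae_mem : ∀ᵐ ω ∂μ, ω ∈ sphere (0 : E3) 1 := by
  rw [ae_iff]; exact hμ.compl

lemma restrict_eq : μ.restrict (sphere (0 : E3) 1) = μ :=
  Measure.restrict_eq_self_of_ae_mem hμ.ae_mem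

lemma aestronglyMeasurable {g : E3 → ℝ} (hg : ContinuousOn g (sphere (0 : E3) 1)) :
    AEStronglyMeasurable g μ := by
  rw [← hμ.restrict_eq]
  exact hg.aestronglyMeasurable isClosed_sphere.measurableSet

lemma integrable {g : E3 → ℝ} (hg : ContinuousOn g (sphere (0 : E3) 1)) : Integrable g μ := by
  have := hμ.prob
  rw [← hμ.restrict_eq]
  exact hg.integrableOn_compact (isCompact_sphere _ _)

lemma abs_integral_le {g : E3 → ℝ} {C : ℝ} (hg : ∀ ω ∈ sphere (0 : E3) 1, |g ω| ≤ C) :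
    |∫ ω, g ω ∂μ| ≤ C := by
  have := hμ.prob
  have h := norm_integral_le_of_norm_le_const (μ := μ) (f := g) (C := C)
    (hμ.ae_mem.mono fun ω hω => hg ω hω)
  simpa using h

lemma continuousOn_integral {g : ℝ → E3 → ℝ} {I : Set ℝ} (hI : IsCompact I)
    (hg : ContinuousOn (fun z : ℝ × E3 => g z.1 z.2) (I ×ˢ sphere (0 : E3) 1)) :
    ContinuousOn (fun r => ∫ ω, g r ω ∂μ) I := by
  have := hμ.prob
  obtain ⟨C, hC⟩ := (hI.prod (isCompact_sphere (0 : E3) 1)).exists_bound_of_continuousOn hg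
  refine continuousOn_of_dominated (bound := fun _ => C) ?_ ?_ (integrable_const _) ?_
  · intro r hr
    exact hμ.aestronglyMeasurable (hg.comp (f := fun ω => (r, ω)) (by fun_prop)
      fun ω hω => ⟨hr, hω⟩)
  · intro r hr
    exact hμ.ae_mem.mono fun ω hω => hC (r, ω) ⟨hr, hω⟩
  · exact hμ.ae_mem.mono fun ω hω => hg.comp (f := fun r => (r, ω)) (by fun_prop)
      fun r hr => ⟨hr, hω⟩

lemma hasDerivAt_integral {g g' : ℝ → E3 → ℝ} {r₀ η : ℝ} (hη : 0 < η)
    (hg : ∀ r ∈ closedBall r₀ η, ∀ ω ∈ sphere (0 : E3) 1,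
      HasDerivAt (fun r => g r ω) (g' r ω) r)
    (hgc : ContinuousOn (fun z : ℝ × E3 => g z.1 z.2) (closedBall r₀ η ×ˢ sphere (0 : E3) 1))
    (hgc' : ContinuousOn (fun z : ℝ × E3 => g' z.1 z.2) (closedBall r₀ η ×ˢ sphere (0 : E3) 1)) :
    HasDerivAt (fun r => ∫ ω, g r ω ∂μ) (∫ ω, g' r₀ ω ∂μ) r₀ := by
  have := hμ.prob
  obtain ⟨C, hC⟩ := ((isCompact_closedBall r₀ η).prod
    (isCompact_sphere (0 : E3) 1)).exists_bound_of_continuousOn hgc'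
  have hr₀ : r₀ ∈ closedBall r₀ η := mem_closedBall_self hη.le
  refine (hasDerivAt_integral_of_dominated_loc_of_deriv_le (bound := fun _ => C)
    (F := g) (F' := g') (s := closedBall r₀ η) (closedBall_mem_nhds r₀ hη) ?_ ?_ ?_ ?_
    (integrable_const _) ?_).2
  · filter_upwards [closedBall_mem_nhds r₀ hη] with r hr
    exact hμ.aestronglyMeasurable (hgc.comp (f := fun ω => (r, ω)) (by fun_prop)
      fun ω hω => ⟨hr, hω⟩)
  · exact hμ.integrable (hgc.comp (f := fun ω => (r₀, ω)) (by fun_prop) fun ω hω => ⟨hr₀, hω⟩)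
  · exact hμ.aestronglyMeasurable
      (hgc'.comp (f := fun ω => (r₀, ω)) (by fun_prop) fun ω hω => ⟨hr₀, hω⟩)
  · exact hμ.ae_mem.mono fun ω hω r hr => hC (r, ω) ⟨hr, hω⟩
  · exact hμ.ae_mem.mono fun ω hω r hr => hg r hr ω hω

/-- The angular derivative of a function has mean zero on spheres. -/
lemma integral_fderiv_rotGen {V : Set E3} (hV : IsOpen V) {K : E3 → ℝ} (hK : ContDiffOn ℝ 1 K V)
    {r : ℝ} (hr : ∀ ω ∈ sphere (0 : E3) 1, r • ω ∈ V) {i j : Fin 3} (hij : i < j) :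
    ∫ ω, fderiv ℝ K (r • ω) (rotGen i j (r • ω)) ∂μ = 0 := by
  have hmem : ∀ θ : ℝ, ∀ ω ∈ sphere (0 : E3) 1, rot hij θ (r • ω) ∈ V := by
    intro θ ω hω
    rw [map_smul]
    apply hr
    simpa using hω
  have hrc : Continuous fun z : ℝ × E3 => rot hij z.1 (r • z.2) := by
    simp only [rot_apply]
    fun_prop
  have hd := hμ.hasDerivAt_integral (r₀ := 0) one_pos (g := fun θ ω => K (rot hij θ (r • ω)))
    (g' := fun θ ω => fderiv ℝ K (rot hij θ (r • ω)) (rotGen i j (rot hij θ (r • ω)))) ?_ ?_ ?_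
  · have hconst : (fun θ : ℝ => ∫ ω, K (rot hij θ (r • ω)) ∂μ) = fun _ => ∫ ω, K (r • ω) ∂μ := by
      ext θ
      have := (hμ.inv (rot hij θ)).integral_comp
        (rot hij θ).toHomeomorph.measurableEmbedding (fun ω => K (r • ω))
      simpa using this
    rw [hconst] at hd
    have h0 := hd.unique (hasDerivAt_const _ _)
    simpa [rot_apply] using h0
  · intro θ _ ω hω
    have h1 : HasFDerivAt K (fderiv ℝ K (rot hij θ (r • ω))) (rot hij θ (r • ω)) :=
      ((hK.contDiffAt (hV.mem_nhds (hmem θ ω hω))).differentiableAt one_ne_zero).hasFDerivAt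
    exact h1.comp_hasDerivAt θ (hasDerivAt_rot hij θ (r • ω))
  · exact hK.continuousOn.comp hrc.continuousOn fun z hz => hmem z.1 z.2 hz.2
  · have h1 : ContinuousOn (fun z : ℝ × E3 => fderiv ℝ K (rot hij z.1 (r • z.2)))
        (closedBall 0 1 ×ˢ sphere (0 : E3) 1) :=
      (hK.continuousOn_fderiv_of_isOpen hV le_rfl).comp hrc.continuousOn
        fun z hz => hmem z.1 z.2 hz.2
    exact h1.clm_apply ((rotGen i j).continuous.comp hrc).continuousOn

end IsSphereMeasure

/-- The unit vector of `ℝ³ × ℝ` in the time direction. -/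
def tvec : E3 × ℝ := (0, 1)

/-- The unit vector of `ℝ³ × ℝ` in the `i`-th spatial direction. -/
def xvec (i : Fin 3) : E3 × ℝ := (basis3 i, 0)

/-- The wave operator `∂_t² - Δ` in terms of the second Fréchet derivative. -/
def wave (u : E3 × ℝ → ℝ) (p : E3 × ℝ) : ℝ :=
  fderiv ℝ (fderiv ℝ u) p tvec tvec - ∑ i, fderiv ℝ (fderiv ℝ u) p (xvec i) (xvec i)

lemma prod_zero_eq_sum (x : E3) : ((x, 0) : E3 × ℝ) = ∑ i, x i • xvec i := by
  simp only [Fin.sum_univ_three, xvec, basis3]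
  ext k
  · fin_cases k <;> simp
  · simp

lemma sum_rotGen_bilin (B : E3 × ℝ →L[ℝ] E3 × ℝ →L[ℝ] ℝ) (hB : ∀ a b, B a b = B b a)
    (x : E3) :
    B (rotGen 0 1 x, 0) (rotGen 0 1 x, 0) + B (rotGen 0 2 x, 0) (rotGen 0 2 x, 0) +
      B (rotGen 1 2 x, 0) (rotGen 1 2 x, 0) =
    ‖x‖ ^ 2 * ∑ i, B (xvec i) (xvec i) - B (x, 0) (x, 0) := by
  have h : ∀ i j, ((rotGen i j x, 0) : E3 × ℝ) = x i • xvec j - x j • xvec i := by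
    intro i j
    simp [rotGen_apply, xvec]
  simp only [h, prod_zero_eq_sum x, EuclideanSpace.real_norm_sq_eq, Fin.sum_univ_three, map_add,
    map_sub, map_smul, _root_.add_apply, _root_.sub_apply,
    _root_.smul_apply, smul_eq_mul, hB (xvec 1) (xvec 0), hB (xvec 2) (xvec 0),
    hB (xvec 2) (xvec 1)]
  ring

lemma fderiv_fderiv_symm {V : Set (E3 × ℝ)} (hV : IsOpen V) {U : E3 × ℝ → ℝ}
    (hU : ContDiffOn ℝ 2 U V) {p : E3 × ℝ} (hp : p ∈ V) (a b : E3 × ℝ) :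
    fderiv ℝ (fderiv ℝ U) p a b = fderiv ℝ (fderiv ℝ U) p b a := by
  have h := (hU.contDiffAt (hV.mem_nhds hp)).isSymmSndFDerivAt (by simp)
  exact h.eq a b

lemma IsSphereMeasure.integral_laplacian {μ : Measure E3} (hμ : IsSphereMeasure μ)
    {V : Set (E3 × ℝ)} (hV : IsOpen V) {U : E3 × ℝ → ℝ} (hU : ContDiffOn ℝ 2 U V) {r s : ℝ}
    (hr : ∀ ω ∈ sphere (0 : E3) 1, (r • ω, s) ∈ V) :
    ∫ ω, (r ^ 2 * ∑ i, fderiv ℝ (fderiv ℝ U) (r • ω, s) (xvec i) (xvec i)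
      - fderiv ℝ (fderiv ℝ U) (r • ω, s) (r • ω, 0) (r • ω, 0)
      - 2 * fderiv ℝ U (r • ω, s) (r • ω, 0)) ∂μ = 0 := by
  have hW : IsOpen {y : E3 | (y, s) ∈ V} := hV.preimage (by fun_prop)
  have hD : ContDiffOn ℝ 1 (fderiv ℝ U) V := hU.fderiv_of_isOpen hV (by norm_num)
  have hι : ContDiff ℝ 1 fun y : E3 => ((y, s) : E3 × ℝ) := by fun_prop
  have hDs : ContDiffOn ℝ 1 (fun y : E3 => fderiv ℝ U (y, s)) {y : E3 | (y, s) ∈ V} :=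
    hD.comp hι.contDiffOn fun y hy => hy
  have hK : ∀ i j, ContDiffOn ℝ 1 (fun y : E3 => fderiv ℝ U (y, s) (rotGen i j y, 0))
      {y : E3 | (y, s) ∈ V} := fun i j =>
    hDs.clm_apply (ContDiff.contDiffOn (by fun_prop))
  have hfd : ∀ i j, ∀ ω ∈ sphere (0 : E3) 1,
      fderiv ℝ (fun y : E3 => fderiv ℝ U (y, s) (rotGen i j y, 0)) (r • ω) (rotGen i j (r • ω)) =
      fderiv ℝ (fderiv ℝ U) (r • ω, s) (rotGen i j (r • ω), 0) (rotGen i j (r • ω), 0) +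
      fderiv ℝ U (r • ω, s) (rotGen i j (rotGen i j (r • ω)), 0) := by
    intro i j ω hω
    have h1 : HasFDerivAt (fun y : E3 => fderiv ℝ U (y, s))
        ((fderiv ℝ (fderiv ℝ U) (r • ω, s)).comp
          ((ContinuousLinearMap.id ℝ E3).prod 0)) (r • ω) := by
      have hd := ((hD.contDiffAt (hV.mem_nhds (hr ω hω))).differentiableAt one_ne_zero).hasFDerivAt
      exact hd.comp (r • ω) ((hasFDerivAt_id _).prodMk (hasFDerivAt_const _ _))
    have h2 : HasFDerivAt (fun y : E3 => ((rotGen i j y, 0) : E3 × ℝ))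
        ((rotGen i j).prod 0) (r • ω) :=
      (rotGen i j).hasFDerivAt.prodMk (hasFDerivAt_const _ _)
    rw [(h1.clm_apply h2).fderiv]
    simp only [_root_.add_apply, ContinuousLinearMap.comp_apply, ContinuousLinearMap.flip_apply,
      ContinuousLinearMap.prod_apply, ContinuousLinearMap.id_apply, _root_.zero_apply]
    ring
  have hint : ∀ i j, Integrable
      (fun ω => fderiv ℝ (fun y : E3 => fderiv ℝ U (y, s) (rotGen i j y, 0)) (r • ω)
        (rotGen i j (r • ω))) μ := by
    intro i j
    refine hμ.integrable (ContinuousOn.clm_apply ?_ (by fun_prop))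
    exact ((hK i j).continuousOn_fderiv_of_isOpen hW le_rfl).comp (by fun_prop) hr
  have h01 := hμ.integral_fderiv_rotGen hW (hK 0 1) hr (show (0 : Fin 3) < 1 by decide)
  have h02 := hμ.integral_fderiv_rotGen hW (hK 0 2) hr (show (0 : Fin 3) < 2 by decide)
  have h12 := hμ.integral_fderiv_rotGen hW (hK 1 2) hr (show (1 : Fin 3) < 2 by decide)
  have hsum := integral_add ((hint 0 1).add (hint 0 2)) (hint 1 2)
  have hsum' := integral_add (hint 0 1) (hint 0 2)
  simp only [Pi.add_apply] at hsum
  rw [hsum', h01, h02, h12] at hsum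
  simp only [add_zero] at hsum
  refine Eq.trans (integral_congr_ae (hμ.ae_mem.mono fun ω hω => ?_)) hsum
  simp only [hfd _ _ ω hω]
  have hb := sum_rotGen_bilin (fderiv ℝ (fderiv ℝ U) (r • ω, s))
    (fderiv_fderiv_symm hV hU (hr ω hω)) (r • ω)
  have hn : ‖r • ω‖ ^ 2 = r ^ 2 := by
    have : ‖ω‖ = 1 := by simpa using hω
    rw [norm_smul, this, mul_one, norm_eq_abs, sq_abs]
  have hl := congrArg ((fderiv ℝ U (r • ω, s)).comp (ContinuousLinearMap.inl ℝ E3 ℝ))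
    (sum_rotGen_rotGen (r • ω))
  rw [map_add, map_add, (ContinuousLinearMap.comp _ _).map_smul] at hl
  simp only [ContinuousLinearMap.comp_apply, ContinuousLinearMap.inl_apply, smul_eq_mul] at hl
  rw [hn] at hb
  linear_combination -hb - hl

/-- Bound for a function at the tip of a backward light cone. -/
lemma abs_tip_le {V : Set (E3 × ℝ)} (hV : IsOpen V) {U : E3 × ℝ → ℝ} (hU : ContDiffOn ℝ 2 U V)
    {τ r₁ A B : ℝ} (hr₁ : 0 < r₁)
    (hmem : ∀ r ∈ Icc 0 r₁, ∀ ω ∈ sphere (0 : E3) 1, (r • ω, τ - r) ∈ V)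
    (hA : ∀ r ∈ Ioo 0 r₁, ∀ ω ∈ sphere (0 : E3) 1, |wave U (r • ω, τ - r)| ≤ A)
    (hB : ∀ ω ∈ sphere (0 : E3) 1,
      |U (r₁ • ω, τ - r₁) + r₁ * fderiv ℝ U (r₁ • ω, τ - r₁) (ω, 1)| ≤ B) :
    |U (0, τ)| ≤ B + r₁ ^ 2 * A := by
  obtain ⟨μ, h1, h2, h3⟩ := exists_sphere_measure
  have hμ : IsSphereMeasure μ := ⟨h1, h2, h3⟩
  have hD : ContDiffOn ℝ 1 (fderiv ℝ U) V := hU.fderiv_of_isOpen hV (by norm_num)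
  set g : ℝ → E3 → ℝ := fun r ω =>
    U (r • ω, τ - r) + r * fderiv ℝ U (r • ω, τ - r) (ω, 1) with hg
  set g' : ℝ → E3 → ℝ := fun r ω =>
    fderiv ℝ U (r • ω, τ - r) (ω, -1) + (fderiv ℝ U (r • ω, τ - r) (ω, 1) +
      r * fderiv ℝ (fderiv ℝ U) (r • ω, τ - r) (ω, -1) (ω, 1)) with hg'
  have hpath : ContinuousOn (fun z : ℝ × E3 => ((z.1 • z.2, τ - z.1) : E3 × ℝ))
      (Icc 0 r₁ ×ˢ sphere (0 : E3) 1) := by fun_prop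
  have hmaps : MapsTo (fun z : ℝ × E3 => ((z.1 • z.2, τ - z.1) : E3 × ℝ))
      (Icc 0 r₁ ×ˢ sphere (0 : E3) 1) V := fun z hz => hmem z.1 hz.1 z.2 hz.2
  have c0 := hU.continuousOn.comp hpath hmaps
  have c1 := hD.continuousOn.comp hpath hmaps
  have c2 := (hD.continuousOn_fderiv_of_isOpen hV le_rfl).comp hpath hmaps
  have hgc : ContinuousOn (fun z : ℝ × E3 => g z.1 z.2) (Icc 0 r₁ ×ˢ sphere (0 : E3) 1) :=
    c0.add (continuousOn_fst.mul (c1.clm_apply (by fun_prop)))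
  have hgc' : ContinuousOn (fun z : ℝ × E3 => g' z.1 z.2) (Icc 0 r₁ ×ˢ sphere (0 : E3) 1) :=
    (c1.clm_apply (by fun_prop)).add ((c1.clm_apply (by fun_prop)).add
      (continuousOn_fst.mul ((c2.clm_apply (by fun_prop)).clm_apply (by fun_prop))))
  have hgd : ∀ r ∈ Icc 0 r₁, ∀ ω ∈ sphere (0 : E3) 1,
      HasDerivAt (fun r => g r ω) (g' r ω) r := by
    intro r hr ω hω
    have hγ : HasDerivAt (fun r : ℝ => ((r • ω, τ - r) : E3 × ℝ)) (ω, -1) r := by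
      have := ((hasDerivAt_id r).smul_const ω).prodMk ((hasDerivAt_id r).const_sub τ)
      simpa using this
    have hn := hV.mem_nhds (hmem r hr ω hω)
    have e0 := (((hU.contDiffAt hn).differentiableAt two_ne_zero).hasFDerivAt).comp_hasDerivAt r hγ
    have e1 := (((hD.contDiffAt hn).differentiableAt one_ne_zero).hasFDerivAt).comp_hasDerivAt r hγ
    have e2 := e1.clm_apply (hasDerivAt_const r ((ω, 1) : E3 × ℝ))
    have e3 := e0.add ((hasDerivAt_id r).mul e2)
    refine HasDerivAt.congr_deriv (f := fun r => g r ω) e3 ?_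
    simp only [hg', Function.comp_apply, id, one_mul, map_zero, add_zero]
  obtain ⟨c, hc, hslope⟩ := exists_hasDerivAt_eq_slope (fun r => ∫ ω, g r ω ∂μ)
    (fun r => ∫ ω, g' r ω ∂μ) hr₁ (hμ.continuousOn_integral isCompact_Icc hgc) (by
      intro r hr
      have hη : 0 < min r (r₁ - r) := lt_min hr.1 (by linarith [hr.2])
      have hsub : closedBall r (min r (r₁ - r)) ⊆ Icc 0 r₁ := by
        rw [Real.closedBall_eq_Icc]
        apply Icc_subset_Icc
        · linarith [min_le_left r (r₁ - r)]
        · linarith [min_le_right r (r₁ - r)]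
      exact hμ.hasDerivAt_integral hη (fun r hr ω hω => hgd r (hsub hr) ω hω)
        (hgc.mono (prod_mono hsub Subset.rfl)) (hgc'.mono (prod_mono hsub Subset.rfl)))
  have hcI : c ∈ Icc 0 r₁ := Ioo_subset_Icc_self hc
  have hkey : ∫ ω, g' c ω ∂μ = ∫ ω, -(c * wave U (c • ω, τ - c)) ∂μ := by
    have hint' : Integrable (fun ω => g' c ω) μ := hμ.integrable
      (hgc'.comp (f := fun ω => (c, ω)) (by fun_prop) fun ω hω => ⟨hcI, hω⟩)
    have hlap := hμ.integral_laplacian hV hU (hmem c hcI)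
    have hint2 : Integrable (fun ω : E3 => (c ^ 2 * ∑ i, fderiv ℝ (fderiv ℝ U) (c • ω, τ - c)
        (xvec i) (xvec i)
      - fderiv ℝ (fderiv ℝ U) (c • ω, τ - c) (c • ω, 0) (c • ω, 0)
      - 2 * fderiv ℝ U (c • ω, τ - c) (c • ω, 0))) μ := by
      have d1 := c1.comp (f := fun ω : E3 => (c, ω)) (s := sphere 0 1) (by fun_prop)
        fun ω hω => ⟨hcI, hω⟩
      have d2 := c2.comp (f := fun ω : E3 => (c, ω)) (s := sphere 0 1) (by fun_prop)
        fun ω hω => ⟨hcI, hω⟩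
      apply hμ.integrable
      refine ((continuousOn_const.mul (continuousOn_finsetSum _ fun i _ => ?_)).sub ?_).sub
        (continuousOn_const.mul ?_)
      · exact (d2.clm_apply continuousOn_const).clm_apply continuousOn_const
      · exact (d2.clm_apply (by fun_prop)).clm_apply (by fun_prop)
      · exact d1.clm_apply (by fun_prop)
    have hadd := integral_add (hint'.const_mul c) hint2
    rw [hlap, add_zero, integral_const_mul] at hadd
    have hc0 : c ≠ 0 := hc.1.ne'
    apply mul_left_cancel₀ hc0
    rw [← hadd, ← integral_const_mul]
    refine integral_congr_ae (hμ.ae_mem.mono fun ω hω => ?_)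
    have hsym := fderiv_fderiv_symm hV hU (hmem c hcI ω hω)
    have e1 : ((c • ω, 0) : E3 × ℝ) = c • (ω, 0) := by simp
    have e2 : ((ω, -1) : E3 × ℝ) = (ω, 0) - tvec := by simp [tvec]
    have e3 : ((ω, 1) : E3 × ℝ) = (ω, 0) + tvec := by simp [tvec]
    simp only [hg', wave, e1, e2, e3, map_add, map_sub, map_smul, _root_.sub_apply,
      _root_.smul_apply, smul_eq_mul, hsym tvec (ω, 0)]
    ring
  have hbd : |∫ ω, g' c ω ∂μ| ≤ r₁ * A := by
    rw [hkey]
    apply hμ.abs_integral_le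
    intro ω hω
    rw [abs_neg, abs_mul, abs_of_pos hc.1]
    exact mul_le_mul hc.2.le (hA c hc ω hω) (abs_nonneg _) hr₁.le
  have hend : |∫ ω, g r₁ ω ∂μ| ≤ B := hμ.abs_integral_le hB
  have hstart : ∫ ω, g 0 ω ∂μ = U (0, τ) := by
    have := hμ.prob
    simp [hg]
  rw [hslope, hstart, sub_zero, abs_div, abs_of_pos hr₁, div_le_iff₀ hr₁] at hbd
  have h5 := abs_le.1 hbd
  have h6 := abs_le.1 hend
  rw [abs_le]
  constructor <;> nlinarith

lemma mem_interior_Dcone {ρ : ℝ} {p : E3 × ℝ} :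
    p ∈ interior (Dcone ρ) ↔ ‖p.1‖ < p.2 ∧ p.2 < 2 * ρ - ‖p.1‖ := by
  constructor
  · intro hp
    rw [mem_interior_iff_mem_nhds] at hp
    have hc : Continuous fun h : ℝ => ((p.1, p.2 + h) : E3 × ℝ) := by fun_prop
    have h0 : ∀ᶠ h in nhds (0 : ℝ), ((p.1, p.2 + h) : E3 × ℝ) ∈ Dcone ρ := by
      apply hc.continuousAt.eventually
      simpa using hp
    obtain ⟨η, hη, hball⟩ := Metric.eventually_nhds_iff.1 h0
    have e1 := hball (y := η / 2) (by simp [abs_of_pos hη]; linarith)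
    have e2 := hball (y := -(η / 2)) (by simp [abs_of_pos hη]; linarith)
    exact ⟨by linarith [e2.2.1], by linarith [e1.2.2]⟩
  · intro hp
    refine mem_interior.2 ⟨{p | ‖p.1‖ < p.2 ∧ p.2 < 2 * ρ - ‖p.1‖}, ?_, ?_, hp⟩
    · rintro q ⟨h1, h2⟩
      exact ⟨by linarith, h1.le, h2.le⟩
    · exact (isOpen_lt continuous_fst.norm continuous_snd).inter
        (isOpen_lt continuous_snd (continuous_const.sub continuous_fst.norm))

lemma convex_Dcone (ρ : ℝ) : Convex ℝ (Dcone ρ) := by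
  intro p hp q hq a b ha hb hab
  obtain ⟨h1, h2, h3⟩ := hp
  obtain ⟨h4, h5, h6⟩ := hq
  have hn : ‖(a • p + b • q).1‖ ≤ a * ‖p.1‖ + b * ‖q.1‖ := by
    refine (norm_add_le _ _).trans ?_
    simp [norm_smul, abs_of_nonneg ha, abs_of_nonneg hb]
  have hs : (a • p + b • q).2 = a * p.2 + b * q.2 := by simp
  have hb' : b = 1 - a := by linarith
  subst hb'
  refine ⟨?_, ?_, ?_⟩ <;> (try rw [hs]) <;> nlinarith

lemma isClosed_Dcone (ρ : ℝ) : IsClosed (Dcone ρ) :=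
  (isClosed_le continuous_fst.norm continuous_const).inter
    ((isClosed_le continuous_fst.norm continuous_snd).inter
      (isClosed_le continuous_snd (continuous_const.sub continuous_fst.norm)))

lemma isCompact_Dcone (ρ : ℝ) : IsCompact (Dcone ρ) := by
  refine ((isCompact_closedBall (0 : E3) ρ).prod (isCompact_Icc (a := 0) (b := 2 * ρ)))
    |>.of_isClosed_subset (isClosed_Dcone ρ) ?_
  rintro p ⟨h1, h2, h3⟩
  have := norm_nonneg p.1
  exact ⟨by simpa using h1, by linarith, by linarith⟩

lemma nonempty_interior_Dcone {ρ : ℝ} (hρ : 0 < ρ) : (interior (Dcone ρ)).Nonempty :=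
  ⟨(0, ρ), mem_interior_Dcone.2 (by simp; constructor <;> linarith)⟩

lemma uniqueDiffOn_Dcone {ρ : ℝ} (hρ : 0 < ρ) : UniqueDiffOn ℝ (Dcone ρ) :=
  uniqueDiffOn_convex (convex_Dcone ρ) (nonempty_interior_Dcone hρ)

/-- The linear map underlying a Lorentz boost. -/
def boost (x : E3) (t a c : ℝ) : E3 × ℝ →L[ℝ] E3 × ℝ :=
  (ContinuousLinearMap.fst ℝ E3 ℝ + (c • (innerSL ℝ x).comp (ContinuousLinearMap.fst ℝ E3 ℝ) +
    a • ContinuousLinearMap.snd ℝ E3 ℝ).smulRight x).prod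
  (a • (t • ContinuousLinearMap.snd ℝ E3 ℝ + (innerSL ℝ x).comp (ContinuousLinearMap.fst ℝ E3 ℝ)))

lemma boost_apply (x : E3) (t a c : ℝ) (p : E3 × ℝ) :
    boost x t a c p = (p.1 + (c * inner ℝ x p.1 + a * p.2) • x, a * (t * p.2 + inner ℝ x p.1)) := by
  simp [boost, mul_add]

/-- The relations making `boost x t a c` a Lorentz transformation. -/
structure IsBoost (x : E3) (t a c : ℝ) : Prop where
  one : a ^ 2 * t ^ 2 - a ^ 2 * ‖x‖ ^ 2 = 1
  two : a * t - 1 - c * ‖x‖ ^ 2 = 0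
  three : a ^ 2 - 2 * c - c ^ 2 * ‖x‖ ^ 2 = 0
  pos : 0 < a
  lt : ‖x‖ < t

lemma exists_isBoost {x : E3} {t : ℝ} (h : ‖x‖ < t) :
    ∃ a c τ : ℝ, IsBoost x t a c ∧ 0 < τ ∧ τ ≤ t ∧ boost x t a c (0, τ) = (x, t) := by
  have hx := norm_nonneg x
  have ht : 0 < t := by linarith
  set τ := √(t ^ 2 - ‖x‖ ^ 2) with hτ
  have hpos : 0 < t ^ 2 - ‖x‖ ^ 2 := by nlinarith
  have hτ0 : 0 < τ := Real.sqrt_pos.2 hpos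
  have hsq : τ ^ 2 = t ^ 2 - ‖x‖ ^ 2 := Real.sq_sqrt hpos.le
  have hx2 : ‖x‖ ^ 2 = t ^ 2 - τ ^ 2 := by linarith
  have htτ : t + τ ≠ 0 := by positivity
  have hτt : τ ≤ t := by nlinarith [sq_nonneg ‖x‖]
  refine ⟨τ⁻¹, (τ * (t + τ))⁻¹, τ, ⟨?_, ?_, ?_, by positivity, h⟩, hτ0, hτt, ?_⟩
  · rw [hx2]; field_simp; ring
  · rw [hx2]; field_simp; ring
  · rw [hx2]; field_simp; ring
  · rw [boost_apply]
    ext <;> simp [hτ0.ne']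
    field_simp

namespace IsBoost

variable {x : E3} {t a c : ℝ} (h : IsBoost x t a c)
include h

lemma form_eq (p : E3 × ℝ) :
    ‖(boost x t a c p).1‖ ^ 2 - (boost x t a c p).2 ^ 2 = ‖p.1‖ ^ 2 - p.2 ^ 2 := by
  rw [boost_apply]
  simp only [norm_add_sq_real, norm_smul, mul_pow, norm_eq_abs, sq_abs, inner_smul_right,
    real_inner_comm]
  set d := inner ℝ x p.1
  linear_combination (-p.2 ^ 2) * h.one - 2 * d * p.2 * a * h.two - d ^ 2 * h.three

lemma snd_nonneg {p : E3 × ℝ} (hp : ‖p.1‖ ≤ p.2) : 0 ≤ (boost x t a c p).2 := by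
  rw [boost_apply]
  have h1 := abs_le.1 (abs_real_inner_le_norm x p.1)
  have h2 : ‖x‖ * ‖p.1‖ ≤ t * p.2 := mul_le_mul h.lt.le hp (norm_nonneg _)
    ((norm_nonneg x).trans h.lt.le)
  exact mul_nonneg h.pos.le (by linarith)

lemma norm_fst_le {p : E3 × ℝ} (hp : ‖p.1‖ ≤ p.2) :
    ‖(boost x t a c p).1‖ ≤ (boost x t a c p).2 := by
  have h1 := h.form_eq p
  have h2 := h.snd_nonneg hp
  have h3 : ‖p.1‖ ^ 2 ≤ p.2 ^ 2 := pow_le_pow_left₀ (norm_nonneg _) hp 2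
  exact le_of_sq_le_sq (by linarith) h2

lemma norm_fst_lt {p : E3 × ℝ} (hp : ‖p.1‖ < p.2) :
    ‖(boost x t a c p).1‖ < (boost x t a c p).2 := by
  have h1 := h.form_eq p
  have h2 := h.snd_nonneg hp.le
  have h3 : ‖p.1‖ ^ 2 < p.2 ^ 2 := pow_lt_pow_left₀ hp (norm_nonneg _) two_ne_zero
  exact lt_of_pow_lt_pow_left₀ 2 h2 (by linarith)

lemma norm_fst_eq {p : E3 × ℝ} (hp : ‖p.1‖ = p.2) :
    ‖(boost x t a c p).1‖ = (boost x t a c p).2 := by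
  have h1 := h.form_eq p
  rw [hp, sub_self, sub_eq_zero] at h1
  exact (sq_eq_sq₀ (norm_nonneg _) (h.snd_nonneg hp.le)).1 h1

lemma bilin_eq (B : E3 × ℝ →L[ℝ] E3 × ℝ →L[ℝ] ℝ) (hB : ∀ a b, B a b = B b a) :
    B (boost x t a c tvec) (boost x t a c tvec) -
      ∑ i, B (boost x t a c (xvec i)) (boost x t a c (xvec i)) =
    B tvec tvec - ∑ i, B (xvec i) (xvec i) := by
  have ht : boost x t a c tvec = a • (x, 0) + (a * t) • tvec := by
    rw [boost_apply]; ext <;> simp [tvec]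
  have hx : ∀ i, boost x t a c (xvec i) = xvec i + (c * x i) • (x, 0) + (a * x i) • tvec := by
    intro i
    rw [boost_apply]
    ext <;> simp [tvec, xvec, basis3, EuclideanSpace.inner_single_right]
  have hn := EuclideanSpace.real_norm_sq_eq x
  have k1 := h.one
  have k2 := h.two
  have k3 := h.three
  simp only [hn, Fin.sum_univ_three] at k1 k2 k3
  simp only [ht, hx, prod_zero_eq_sum x, Fin.sum_univ_three, map_add, map_smul, _root_.add_apply,
    _root_.smul_apply, smul_eq_mul, hB (xvec 1) (xvec 0), hB (xvec 2) (xvec 0),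
    hB (xvec 2) (xvec 1), hB (xvec 0) tvec, hB (xvec 1) tvec, hB (xvec 2) tvec]
  linear_combination B tvec tvec * k1 + (2 * a * (x 0 * B tvec (xvec 0) + x 1 * B tvec (xvec 1) +
    x 2 * B tvec (xvec 2))) * k2 + (x 0 ^ 2 * B (xvec 0) (xvec 0) + x 1 ^ 2 * B (xvec 1) (xvec 1) +
    x 2 ^ 2 * B (xvec 2) (xvec 2) + 2 * x 0 * x 1 * B (xvec 0) (xvec 1) +
    2 * x 0 * x 2 * B (xvec 0) (xvec 2) + 2 * x 1 * x 2 * B (xvec 1) (xvec 2)) * k3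

end IsBoost

lemma wave_comp_boost {x : E3} {t a c : ℝ} (h : IsBoost x t a c) {W : Set (E3 × ℝ)}
    (hW : IsOpen W) {u : E3 × ℝ → ℝ} (hu : ContDiffOn ℝ 2 u W) {p : E3 × ℝ}
    (hp : boost x t a c p ∈ W) :
    wave (u ∘ boost x t a c) p = wave u (boost x t a c p) := by
  set Λ := boost x t a c
  have hD : ContDiffOn ℝ 1 (fderiv ℝ u) W := hu.fderiv_of_isOpen hW (by norm_num)
  have hV : IsOpen (Λ ⁻¹' W) := hW.preimage Λ.continuous
  have h1 : fderiv ℝ (u ∘ Λ) =ᶠ[nhds p] fun y => (fderiv ℝ u (Λ y)).comp Λ := by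
    filter_upwards [hV.mem_nhds hp] with y hy
    have := ((hu.contDiffAt (hW.mem_nhds hy)).differentiableAt two_ne_zero).hasFDerivAt
    exact (this.comp y Λ.hasFDerivAt).fderiv
  have h2 : HasFDerivAt (fun y => fderiv ℝ u (Λ y)) ((fderiv ℝ (fderiv ℝ u) (Λ p)).comp Λ) p :=
    ((hD.contDiffAt (hW.mem_nhds hp)).differentiableAt one_ne_zero).hasFDerivAt.comp p
      Λ.hasFDerivAt
  have h3 : ∀ a b, fderiv ℝ (fderiv ℝ (u ∘ Λ)) p a b =
      fderiv ℝ (fderiv ℝ u) (Λ p) (Λ a) (Λ b) := by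
    intro a b
    rw [h1.fderiv_eq, (h2.clm_comp (hasFDerivAt_const Λ p)).fderiv]
    simp
  simp only [wave, h3]
  exact h.bilin_eq _ (fderiv_fderiv_symm hW hu hp)

/-- A function on the double cone is bounded by its wave operator in the interior together with
the derivative of `σ ↦ σ u(σ x, σ |x|)` on the characteristic cone. -/
lemma abs_le_of_cone_data {ρ A B : ℝ} {u : E3 × ℝ → ℝ} (hu : ContDiffOn ℝ 2 u (Dcone ρ))
    (hA : ∀ p ∈ interior (Dcone ρ), |wave u p| ≤ A)
    (hB : ∀ x : E3, ‖x‖ < ρ →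
      |u (x, ‖x‖) + fderivWithin ℝ u (Dcone ρ) (x, ‖x‖) (x, ‖x‖)| ≤ B) :
    ∀ p ∈ interior (Dcone ρ), |u p| ≤ B + ρ ^ 2 * A := by
  intro p hp
  have hp' := mem_interior_Dcone.1 hp
  have hn := norm_nonneg p.1
  have hρ : 0 < ρ := by linarith [hp'.1, hp'.2]
  have hA0 : 0 ≤ A := (abs_nonneg _).trans (hA p hp)
  obtain ⟨a, c, τ, hb, hτ, hτt, hbp⟩ := exists_isBoost hp'.1
  set Λ := boost p.1 p.2 a c with hΛ
  have hpt : ∀ r (ω : E3), Λ (r • ω, τ - r) = p - r • Λ (-ω, 1) := by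
    intro r ω
    have e1 : ((r • ω, τ - r) : E3 × ℝ) = (0, τ) - r • (-ω, 1) := by
      ext <;> simp
    have e2 : Λ (0, τ) = p := hbp
    rw [e1, map_sub, map_smul, e2]
  have hsph : ∀ ω ∈ sphere (0 : E3) 1, ‖ω‖ = 1 := fun ω hω => by simpa using hω
  have hback : ∀ r, 0 ≤ r → ∀ ω ∈ sphere (0 : E3) 1,
      ‖(Λ (r • ω, τ - r)).1‖ + (Λ (r • ω, τ - r)).2 < 2 * ρ := by
    intro r hr ω hω
    have h1 := hb.norm_fst_le (p := (-ω, 1)) (by simp [hsph ω hω])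
    rw [← hΛ] at h1
    rw [hpt r ω]
    have h2 : ‖(p - r • Λ (-ω, 1)).1‖ ≤ ‖p.1‖ + r * ‖(Λ (-ω, 1)).1‖ := by
      refine (norm_sub_le _ _).trans ?_
      simp [norm_smul, abs_of_nonneg hr]
    have h3 : (p - r • Λ (-ω, 1)).2 = p.2 - r * (Λ (-ω, 1)).2 := by simp
    rw [h3]
    have := mul_le_mul_of_nonneg_left h1 hr
    linarith [hp'.2]
  have hint : ∀ r, 0 ≤ r → r < τ / 2 → ∀ ω ∈ sphere (0 : E3) 1,
      Λ (r • ω, τ - r) ∈ interior (Dcone ρ) := by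
    intro r hr hr2 ω hω
    have h1 := hback r hr ω hω
    have h2 := hb.norm_fst_lt (p := (r • ω, τ - r))
      (by simp [norm_smul, hsph ω hω, abs_of_nonneg hr]; linarith)
    exact mem_interior_Dcone.2 ⟨h2, by linarith⟩
  have hclosed : ∀ r ∈ Icc 0 (τ / 2), ∀ ω ∈ sphere (0 : E3) 1,
      Λ (r • ω, τ - r) ∈ Dcone ρ := by
    intro r hr ω hω
    have h1 := hback r hr.1 ω hω
    have h2 := hb.norm_fst_le (p := (r • ω, τ - r))
      (by simp [norm_smul, hsph ω hω, abs_of_nonneg hr.1]; linarith [hr.2])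
    rw [← hΛ] at h2
    exact ⟨by linarith, h2, by linarith⟩
  have hD : ContinuousOn (fderivWithin ℝ u (Dcone ρ)) (Dcone ρ) :=
    hu.continuousOn_fderivWithin (uniqueDiffOn_Dcone hρ) (by norm_num)
  set g : ℝ × E3 → ℝ := fun z => u (Λ (z.1 • z.2, τ - z.1)) +
    z.1 * fderivWithin ℝ u (Dcone ρ) (Λ (z.1 • z.2, τ - z.1)) (Λ (z.2, 1)) with hg
  have hK : IsCompact (Icc 0 (τ / 2) ×ˢ sphere (0 : E3) 1) :=
    isCompact_Icc.prod (isCompact_sphere _ _)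
  have hgc : ContinuousOn g (Icc 0 (τ / 2) ×ˢ sphere (0 : E3) 1) := by
    have hpath : ContinuousOn (fun z : ℝ × E3 => Λ (z.1 • z.2, τ - z.1))
      (Icc 0 (τ / 2) ×ˢ sphere (0 : E3) 1) := by fun_prop
    have hm : MapsTo (fun z : ℝ × E3 => Λ (z.1 • z.2, τ - z.1))
      (Icc 0 (τ / 2) ×ˢ sphere (0 : E3) 1) (Dcone ρ) := fun z hz => hclosed z.1 hz.1 z.2 hz.2
    exact (hu.continuousOn.comp hpath hm).add
      (continuousOn_fst.mul ((hD.comp hpath hm).clm_apply (by fun_prop)))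
  have hgu := Metric.uniformContinuousOn_iff.1 (hK.uniformContinuousOn_of_continuous hgc)
  have hgend : ∀ ω ∈ sphere (0 : E3) 1, |g (τ / 2, ω)| ≤ B := by
    intro ω hω
    set γ := Λ ((τ / 2) • ω, τ - τ / 2) with hγ
    have e1 : γ = (τ / 2) • Λ (ω, 1) := by
      rw [hγ, ← map_smul]
      congr 1
      ext <;> simp
      ring
    have e2 : ‖γ.1‖ = γ.2 := hb.norm_fst_eq (by
      simp [norm_smul, hsph ω hω, abs_of_pos hτ]; ring)
    have e3 := hback (τ / 2) (by positivity) ω hω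
    rw [← hγ] at e3
    have e4 := hB γ.1 (by linarith)
    rw [e2] at e4
    change |u γ + τ / 2 * fderivWithin ℝ u (Dcone ρ) γ (Λ (ω, 1))| ≤ B
    rw [← smul_eq_mul, ← map_smul, ← e1]
    exact e4
  refine le_of_forall_pos_le_add fun ε hε => ?_
  obtain ⟨δ, hδ, hgδ⟩ := hgu ε hε
  set r₁ := τ / 2 - min (δ / 2) (τ / 4) with hr₁
  have hmin : 0 < min (δ / 2) (τ / 4) := by positivity
  have hr₁0 : 0 < r₁ := by linarith [min_le_right (δ / 2) (τ / 4)]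
  have hr₁2 : r₁ < τ / 2 := by linarith
  have hV : IsOpen (Λ ⁻¹' interior (Dcone ρ)) := isOpen_interior.preimage Λ.continuous
  have hui : ContDiffOn ℝ 2 u (interior (Dcone ρ)) := hu.mono interior_subset
  have hU : ContDiffOn ℝ 2 (u ∘ Λ) (Λ ⁻¹' interior (Dcone ρ)) :=
    hui.comp Λ.contDiff.contDiffOn fun y hy => hy
  have key := abs_tip_le (τ := τ) (A := A) (B := B + ε) hV hU hr₁0
    (fun r hr ω hω => hint r hr.1 (by linarith [hr.2]) ω hω)
    (fun r hr ω hω => by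
      have hm := hint r hr.1.le (by linarith [hr.2]) ω hω
      rw [wave_comp_boost hb isOpen_interior hui hm]
      exact hA _ hm)
    (fun ω hω => by
      have hm := hint r₁ hr₁0.le hr₁2 ω hω
      have e1 := hgδ (r₁, ω) ⟨⟨hr₁0.le, hr₁2.le⟩, hω⟩ (τ / 2, ω) ⟨⟨by positivity, le_rfl⟩, hω⟩ (by
        rw [Prod.dist_eq, dist_self, max_lt_iff, Real.dist_eq]
        refine ⟨?_, hδ⟩
        rw [hr₁, sub_sub_cancel_left, abs_neg, abs_of_pos hmin]
        linarith [min_le_left (δ / 2) (τ / 4)])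
      rw [Real.dist_eq] at e1
      have e2 := hgend ω hω
      have e3 : fderiv ℝ (u ∘ Λ) (r₁ • ω, τ - r₁) (ω, 1) =
          fderivWithin ℝ u (Dcone ρ) (Λ (r₁ • ω, τ - r₁)) (Λ (ω, 1)) := by
        rw [fderivWithin_of_mem_nhds (mem_interior_iff_mem_nhds.1 hm)]
        have := ((hui.contDiffAt (isOpen_interior.mem_nhds hm)).differentiableAt
          two_ne_zero).hasFDerivAt
        rw [(this.comp _ Λ.hasFDerivAt).fderiv]
        rfl
      rw [e3]
      change |g (r₁, ω)| ≤ B + ε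
      have := abs_sub_abs_le_abs_sub (g (r₁, ω)) (g (τ / 2, ω))
      linarith)
  have e5 : (u ∘ Λ) (0, τ) = u p := by
    rw [Function.comp_apply, hbp]
  rw [e5] at key
  have e6 : r₁ ^ 2 ≤ ρ ^ 2 := pow_le_pow_left₀ hr₁0.le (by linarith [hp'.2]) 2
  have := mul_le_mul_of_nonneg_right e6 hA0
  linarith

/-- Real polynomials in the time variable (`none`) and the space variables (`some i`). -/
abbrev STPoly : Type := MvPolynomial (Option (Fin 3)) ℝ

/-- The coordinate functions of `ℝ³ × ℝ`. -/
def coord : Option (Fin 3) → (E3 × ℝ →L[ℝ] ℝ)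
  | none => ContinuousLinearMap.snd ℝ E3 ℝ
  | some i => (EuclideanSpace.proj i).comp (ContinuousLinearMap.fst ℝ E3 ℝ)

/-- The coordinate vectors of `ℝ³ × ℝ`. -/
def cvec : Option (Fin 3) → E3 × ℝ
  | none => tvec
  | some i => xvec i

/-- The Minkowski signature. -/
def eta : Option (Fin 3) → ℝ
  | none => 1
  | some _ => -1

@[simp] lemma coord_none (p : E3 × ℝ) : coord none p = p.2 := rfl

@[simp] lemma coord_some (i : Fin 3) (p : E3 × ℝ) : coord (some i) p = p.1 i := rfl

lemma coord_cvec (a b : Option (Fin 3)) : coord a (cvec b) = if a = b then 1 else 0 := by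
  cases a <;> cases b <;> simp [cvec, tvec, xvec, basis3]

lemma sum_coord_smul_cvec (p : E3 × ℝ) : ∑ a, coord a p • cvec a = p := by
  have h := prod_zero_eq_sum p.1
  rw [Fintype.sum_option]
  simp only [coord_none, coord_some, cvec, ← h, tvec]
  ext <;> simp

namespace STPoly

open MvPolynomial

/-- Evaluation of a polynomial at a point of `ℝ³ × ℝ`. -/
def ev (P : STPoly) (p : E3 × ℝ) : ℝ := eval (fun a => coord a p) P

@[simp] lemma ev_add (P R : STPoly) (p : E3 × ℝ) : ev (P + R) p = ev P p + ev R p := by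
  simp [ev]

@[simp] lemma ev_sub (P R : STPoly) (p : E3 × ℝ) : ev (P - R) p = ev P p - ev R p := by
  simp [ev]

@[simp] lemma ev_mul (P R : STPoly) (p : E3 × ℝ) : ev (P * R) p = ev P p * ev R p := by
  simp [ev]

@[simp] lemma ev_smul (c : ℝ) (P : STPoly) (p : E3 × ℝ) : ev (c • P) p = c * ev P p := by
  simp [ev, smul_eq_C_mul]

@[simp] lemma ev_zero (p : E3 × ℝ) : ev 0 p = 0 := by simp [ev]

@[simp] lemma ev_X (a : Option (Fin 3)) (p : E3 × ℝ) : ev (X a) p = coord a p := by simp [ev]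

@[simp] lemma ev_C (c : ℝ) (p : E3 × ℝ) : ev (C c) p = c := by simp [ev]

@[simp] lemma ev_sum {ι : Type*} (s : Finset ι) (P : ι → STPoly) (p : E3 × ℝ) :
    ev (∑ i ∈ s, P i) p = ∑ i ∈ s, ev (P i) p := by simp [ev]

lemma hasFDerivAt_ev (P : STPoly) (p : E3 × ℝ) :
    HasFDerivAt (ev P) (∑ a, ev (pderiv a P) p • coord a) p := by
  induction P using MvPolynomial.induction_on with
  | C c =>
    have : ev (C c) = fun _ => c := by ext; simp
    rw [this]
    simpa using hasFDerivAt_const c p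
  | add P R hP hR =>
    have : ev (P + R) = fun q => ev P q + ev R q := by ext; simp
    rw [this]
    refine (hP.add hR).congr_fderiv ?_
    simp [add_smul, Finset.sum_add_distrib]
  | mul_X P b hP =>
    have : ev (P * X b) = fun q => ev P q * coord b q := by ext; simp
    rw [this]
    refine (hP.mul (coord b).hasFDerivAt).congr_fderiv ?_
    simp only [pderiv_mul, pderiv_X, ev_add, ev_mul, ev_X, add_smul, Finset.sum_add_distrib]
    rw [add_comm, Finset.smul_sum]
    congr 1
    · exact Finset.sum_congr rfl fun a _ => by rw [mul_comm, mul_smul]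
    · rw [Finset.sum_eq_single b]
      · simp [ev]
      · intro a _ ha
        simp [ha.symm]
      · simp

lemma fderiv_ev (P : STPoly) (p v : E3 × ℝ) :
    fderiv ℝ (ev P) p v = ∑ a, ev (pderiv a P) p * coord a v := by
  simp [(hasFDerivAt_ev P p).fderiv]

lemma contDiff_ev (P : STPoly) {n : WithTop ℕ∞} : ContDiff ℝ n (ev P) := by
  induction P using MvPolynomial.induction_on with
  | C c =>
    have : ev (C c) = fun _ => c := by ext; simp
    rw [this]; exact contDiff_const
  | add P R hP hR =>
    have : ev (P + R) = fun q => ev P q + ev R q := by ext; simp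
    rw [this]; exact hP.add hR
  | mul_X P b hP =>
    have : ev (P * X b) = fun q => ev P q * coord b q := by ext; simp
    rw [this]; exact hP.mul (coord b).contDiff

lemma fderiv_fderiv_ev (P : STPoly) (p v w : E3 × ℝ) :
    fderiv ℝ (fderiv ℝ (ev P)) p v w =
      ∑ a, ∑ b, ev (pderiv b (pderiv a P)) p * coord b v * coord a w := by
  have h1 : fderiv ℝ (ev P) = fun q => ∑ a, ev (pderiv a P) q • coord a := by
    ext1 q; exact (hasFDerivAt_ev P q).fderiv
  have h2 : HasFDerivAt (fun q => ∑ a, ev (pderiv a P) q • coord a)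
      (∑ a, (∑ b, ev (pderiv b (pderiv a P)) p • coord b).smulRight (coord a)) p :=
    HasFDerivAt.fun_sum fun a _ =>
      HasFDerivAt.smul_const (hasFDerivAt_ev (pderiv a P) p) (coord a)
  rw [h1, h2.fderiv]
  simp [-Fintype.sum_option, Finset.sum_mul]

lemma pderiv_comm (a b : Option (Fin 3)) (P : STPoly) :
    pderiv a (pderiv b P) = pderiv b (pderiv a P) := by
  have h : ⁅pderiv (R := ℝ) a, pderiv (R := ℝ) b⁆ = (0 : Derivation ℝ STPoly STPoly) := by
    apply MvPolynomial.derivation_ext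
    intro c
    rw [Derivation.commutator_apply]
    simp [pderiv_X, Pi.single_apply, apply_ite]
  have hD := congrArg (fun D : Derivation ℝ STPoly STPoly => D P) h
  simp only [Derivation.commutator_apply, Derivation.zero_apply] at hD
  exact sub_eq_zero.1 hD

/-- The wave operator on polynomials. -/
def box : STPoly →ₗ[ℝ] STPoly :=
  (pderiv none).toLinearMap ∘ₗ (pderiv none).toLinearMap -
    ∑ i : Fin 3, (pderiv (some i)).toLinearMap ∘ₗ (pderiv (some i)).toLinearMap

lemma box_apply (P : STPoly) : box P = pderiv none (pderiv none P) -
    ∑ i : Fin 3, pderiv (some i) (pderiv (some i) P) := by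
  simp [box]

/-- The Euler operator on polynomials. -/
def euler : STPoly →ₗ[ℝ] STPoly :=
  ∑ a : Option (Fin 3), (LinearMap.mulLeft ℝ (X a : STPoly)) ∘ₗ (pderiv a).toLinearMap

lemma euler_apply (P : STPoly) : euler P = ∑ a : Option (Fin 3), X a * pderiv a P := by
  simp [euler]

/-- The Lorentz form `t² - |x|²`. -/
def lor : STPoly := X none * X none - ∑ i : Fin 3, X (some i) * X (some i)

lemma ev_lor (p : E3 × ℝ) : ev lor p = p.2 ^ 2 - ‖p.1‖ ^ 2 := by
  rw [EuclideanSpace.real_norm_sq_eq]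
  simp [lor, sq]

lemma wave_ev (P : STPoly) (p : E3 × ℝ) : wave (ev P) p = ev (box P) p := by
  have h : ∀ a, fderiv ℝ (fderiv ℝ (ev P)) p (cvec a) (cvec a) = ev (pderiv a (pderiv a P)) p := by
    intro a
    rw [fderiv_fderiv_ev]
    simp [coord_cvec]
  simp only [wave, box_apply, ev_sub, ev_sum, ← h]
  rfl

lemma fderiv_ev_self (P : STPoly) (p : E3 × ℝ) : fderiv ℝ (ev P) p p = ev (euler P) p := by
  rw [fderiv_ev, euler_apply]
  simp [mul_comm]

lemma pderiv_lor (a : Option (Fin 3)) : pderiv a lor = (2 * eta a) • X a := by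
  have h2 : (C 2 : STPoly) = 2 := map_ofNat C 2
  rw [smul_eq_C_mul]
  cases a <;> simp [lor, eta, h2, pderiv_X, Fin.sum_univ_three, Pi.single_apply, map_sub]
  · ring
  · rename_i i
    fin_cases i <;> simp <;> ring

lemma box_comm (a : Option (Fin 3)) (P : STPoly) : box (pderiv a P) = pderiv a (box P) := by
  simp only [box_apply, map_sub, map_sum]
  rw [pderiv_comm none a, pderiv_comm none a]
  simp only [pderiv_comm (some _) a]

lemma euler_pderiv (a : Option (Fin 3)) (P : STPoly) :
    pderiv a (euler P) = euler (pderiv a P) + pderiv a P := by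
  simp only [euler_apply, map_sum, pderiv_mul, pderiv_X, Finset.sum_add_distrib]
  rw [add_comm]
  refine congrArg₂ (· + ·) (Finset.sum_congr rfl fun b _ => by rw [pderiv_comm]) ?_
  rw [Finset.sum_eq_single a]
  · simp
  · intro b _ hb; simp [hb]
  · simp

lemma euler_mul (P R : STPoly) : euler (P * R) = euler P * R + P * euler R := by
  simp only [euler_apply, pderiv_mul, Finset.sum_mul, Finset.mul_sum, ← Finset.sum_add_distrib]
  exact Finset.sum_congr rfl fun b _ => by ring

lemma euler_X (a : Option (Fin 3)) : euler (X a) = X a := by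
  rw [euler_apply, Finset.sum_eq_single a]
  · simp
  · intro b _ hb; simp [pderiv_X, hb.symm]
  · simp

lemma euler_lor : euler lor = (2 : ℝ) • lor := by
  simp only [lor, map_sub, map_sum, euler_mul, euler_X, smul_sub, Finset.smul_sum]
  simp only [two_smul]

lemma box_euler (P : STPoly) : box (euler P) = euler (box P) + (2 : ℝ) • box P := by
  simp only [box_apply, euler_pderiv, map_add, map_sub, map_sum, Finset.sum_add_distrib, two_smul]
  ring

lemma box_lor_mul (P : STPoly) :
    box (lor * P) = lor * box P + (4 : ℝ) • euler P + (8 : ℝ) • P := by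
  simp only [box_apply, pderiv_mul, map_add, pderiv_lor, Derivation.map_smul, pderiv_X_self,
    euler_apply, Fintype.sum_option, Fin.sum_univ_three, eta]
  simp only [smul_eq_C_mul, map_mul, map_neg, map_one, map_ofNat]
  ring

end STPoly

/-- The characteristic cone `t = |x|`, `|x| ≤ ρ`. -/
def lightCone (ρ : ℝ) : Set (E3 × ℝ) := {p | ‖p.1‖ = p.2 ∧ ‖p.1‖ ≤ ρ}

lemma lightCone_subset_Dcone (ρ : ℝ) : lightCone ρ ⊆ Dcone ρ := fun p hp =>
  ⟨hp.2, hp.1.le, by linarith [hp.1, hp.2]⟩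

lemma smul_mem_lightCone {ρ σ : ℝ} {p : E3 × ℝ} (hp : p ∈ lightCone ρ) (h0 : 0 ≤ σ) (h1 : σ ≤ 1) :
    σ • p ∈ lightCone ρ := by
  refine ⟨?_, ?_⟩
  · simp [norm_smul, abs_of_nonneg h0, hp.1]
  · simp only [Prod.smul_fst, norm_smul, norm_eq_abs, abs_of_nonneg h0]
    exact (mul_le_of_le_one_left (norm_nonneg _) h1).trans hp.2

lemma abs_coord_le_of_mem_Dcone {ρ : ℝ} {p : E3 × ℝ} (hp : p ∈ Dcone ρ) (a : Option (Fin 3)) :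
    |coord a p| ≤ 2 * ρ := by
  have h0 := norm_nonneg p.1
  obtain ⟨h1, h2, h3⟩ := hp
  cases a with
  | none => rw [coord_none, abs_of_nonneg (by linarith)]; linarith
  | some i =>
    have := PiLp.norm_apply_le p.1 i
    rw [coord_some]
    rw [norm_eq_abs] at this
    linarith

namespace STPoly

open MvPolynomial

lemma ev_lor_of_mem {ρ : ℝ} {p : E3 × ℝ} (hp : p ∈ lightCone ρ) : ev lor p = 0 := by
  rw [ev_lor, hp.1, sub_self]

lemma abs_ev_le_of_data {ρ A B : ℝ} {P : STPoly} (hρ : 0 < ρ)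
    (hA : ∀ p ∈ Dcone ρ, |ev (box P) p| ≤ A)
    (hB : ∀ p ∈ lightCone ρ, |ev (P + euler P) p| ≤ B) :
    ∀ p ∈ interior (Dcone ρ), |ev P p| ≤ B + ρ ^ 2 * A := by
  apply abs_le_of_cone_data (contDiff_ev P).contDiffOn
  · intro p hp
    rw [wave_ev]
    exact hA p (interior_subset hp)
  · intro x hx
    have hm : ((x, ‖x‖) : E3 × ℝ) ∈ lightCone ρ := ⟨rfl, hx.le⟩
    rw [fderivWithin_eq_fderiv (uniqueDiffOn_Dcone hρ _ (lightCone_subset_Dcone ρ hm))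
      (hasFDerivAt_ev P _).differentiableAt, fderiv_ev_self, ← ev_add]
    exact hB _ hm

/-- Inversion of `euler + k` along rays. -/
lemma abs_ev_le_of_euler {ρ M : ℝ} {k : ℕ} {P : STPoly} (hk : 0 < k)
    (hM : ∀ p ∈ lightCone ρ, |ev (euler P) p + k * ev P p| ≤ M) :
    ∀ p ∈ lightCone ρ, |ev P p| ≤ M / k := by
  intro p hp
  have hk' : (k : ℝ) ≠ 0 := by positivity
  have hd : ∀ σ : ℝ, HasDerivAt (fun σ : ℝ => σ ^ k * ev P (σ • p))
      (σ ^ (k - 1) * (ev (euler P) (σ • p) + k * ev P (σ • p))) σ := by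
    intro σ
    have h1 : HasDerivAt (fun σ : ℝ => σ • p) p σ := by
      simpa using (hasDerivAt_id σ).smul_const p
    have h2 := (hasFDerivAt_ev P (σ • p)).differentiableAt.hasFDerivAt.comp_hasDerivAt σ h1
    refine ((hasDerivAt_pow k σ).mul h2).congr_deriv ?_
    have h3 : σ * fderiv ℝ (ev P) (σ • p) p = ev (euler P) (σ • p) := by
      rw [← fderiv_ev_self, map_smul, smul_eq_mul]
    have h4 : σ ^ k = σ ^ (k - 1) * σ := by rw [← pow_succ, Nat.sub_add_cancel hk]
    simp only [Function.comp_apply]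
    rw [h4, mul_assoc _ σ, h3]
    ring
  have hB : ∀ σ : ℝ, HasDerivAt (fun σ : ℝ => M / k * σ ^ k) (M * σ ^ (k - 1)) σ := by
    intro σ
    refine ((hasDerivAt_pow k σ).const_mul (M / k)).congr_deriv ?_
    field_simp
  have key := image_norm_le_of_norm_deriv_right_le_deriv_boundary
    (fun σ _ => (hd σ).continuousAt.continuousWithinAt (s := Icc 0 1))
    (fun σ _ => (hd σ).hasDerivWithinAt) (by simp [hk.ne']) hB
    (fun σ hσ => by
      rw [norm_mul, norm_pow, norm_eq_abs, norm_eq_abs, abs_of_nonneg hσ.1, mul_comm]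
      exact mul_le_mul_of_nonneg_right (hM _ (smul_mem_lightCone hp hσ.1 hσ.2.le))
        (pow_nonneg hσ.1 _))
    (right_mem_Icc.2 zero_le_one)
  simpa using key

lemma lor_mul_data {ρ : ℝ} (P : STPoly) {p : E3 × ℝ} (hp : p ∈ lightCone ρ) :
    ev (lor * P + euler (lor * P)) p = 0 := by
  simp [euler_mul, euler_lor, ev_lor_of_mem hp]

lemma eq_zero_of_box_lor_mul {P : STPoly} (h : box (lor * P) = 0) : P = 0 := by
  have h1 := abs_ev_le_of_data (ρ := 1) (A := 0) (B := 0) (P := lor * P) one_pos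
    (fun p _ => by simp [h]) (fun p hp => by rw [lor_mul_data P hp, abs_zero])
  have h2 : ∀ p ∈ interior (Dcone 1), ev P p = 0 := by
    intro p hp
    have h3 := h1 p hp
    have h4 := mem_interior_Dcone.1 hp
    have h5 : 0 < ev lor p := by
      rw [ev_lor]
      have := pow_lt_pow_left₀ h4.1 (norm_nonneg _) two_ne_zero
      linarith
    have h6 : ev (lor * P) p = 0 := abs_nonpos_iff.1 (by simpa using h3)
    rw [ev_mul] at h6
    exact (mul_eq_zero.1 h6).resolve_left h5.ne'
  set s : Option (Fin 3) → Set ℝ := fun a => Option.elim a (Ioo (9 / 10) (11 / 10))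
    fun _ => Ioo (-(1 / 10)) (1 / 10) with hs
  refine MvPolynomial.funext_set s ?_ fun x hx => ?_
  · rintro (_ | i)
    · exact Ioo_infinite (by norm_num)
    · exact Ioo_infinite (by norm_num)
  · have hx0 : x none ∈ Ioo (9 / 10 : ℝ) (11 / 10) := hx none (mem_univ _)
    have hxi : ∀ i, x (some i) ∈ Ioo (-(1 / 10) : ℝ) (1 / 10) := fun i => hx (some i) (mem_univ _)
    set p : E3 × ℝ := (WithLp.toLp 2 fun i => x (some i), x none) with hp
    have hc : (fun a => coord a p) = x := by
      ext a
      cases a <;> simp [hp]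
    have hn : ‖p.1‖ < 1 / 2 := by
      refine lt_of_pow_lt_pow_left₀ 2 (by norm_num) ?_
      rw [EuclideanSpace.real_norm_sq_eq, Fin.sum_univ_three]
      have hb : ∀ i, p.1 i ^ 2 ≤ 1 / 100 := by
        intro i
        have := hxi i
        change x (some i) ^ 2 ≤ 1 / 100
        nlinarith [this.1, this.2]
      linarith [hb 0, hb 1, hb 2]
    have hmem : p ∈ interior (Dcone 1) := mem_interior_Dcone.2
      ⟨by change _ < x none; linarith [hx0.1], by change x none < _; linarith [hx0.2]⟩
    have := h2 p hmem
    rw [ev, hc] at this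
    rw [this, map_zero]

lemma exists_box_lor_mul_eq (F : STPoly) : ∃ P : STPoly, box (lor * P) = F := by
  have hom : ∀ n, ∀ F ∈ homogeneousSubmodule (Option (Fin 3)) ℝ n,
      ∃ P : STPoly, box (lor * P) = F := by
    intro n F hF
    have hlor : (lor : STPoly).IsHomogeneous 2 := by
      have hX : ∀ a : Option (Fin 3), (X a * X a : STPoly).IsHomogeneous 2 := fun a =>
        (isHomogeneous_X ℝ a).mul (isHomogeneous_X ℝ a)
      exact (hX none).sub (IsHomogeneous.sum _ _ _ fun i _ => hX (some i))
    set T : STPoly →ₗ[ℝ] STPoly := box ∘ₗ LinearMap.mulLeft ℝ lor with hT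
    have hmap : ∀ P ∈ homogeneousSubmodule (Option (Fin 3)) ℝ n,
        T P ∈ homogeneousSubmodule (Option (Fin 3)) ℝ n := by
      intro P hP
      have h1 : (lor * P).IsHomogeneous (n + 2) := by
        rw [add_comm]; exact hlor.mul hP
      have h2 : ∀ a : Option (Fin 3), (pderiv a (pderiv a (lor * P))).IsHomogeneous n := fun a =>
        (h1.pderiv (i := a)).pderiv (i := a)
      change (box (lor * P)).IsHomogeneous n
      rw [box_apply]
      exact (h2 none).sub (IsHomogeneous.sum _ _ _ fun i _ => h2 (some i))
    have : FiniteDimensional ℝ (homogeneousSubmodule (Option (Fin 3)) ℝ n) :=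
      Module.Finite.of_fg (homogeneousSubmodule_fg _ _ n)
    have hinj : Function.Injective (T.restrict hmap) := by
      rw [← LinearMap.ker_eq_bot, LinearMap.ker_eq_bot']
      intro P hP
      have : T P = 0 := congrArg Subtype.val hP
      exact Subtype.ext (eq_zero_of_box_lor_mul this)
    obtain ⟨P, hP⟩ := (LinearMap.injective_iff_surjective.1 hinj) ⟨F, hF⟩
    exact ⟨P, congrArg Subtype.val hP⟩
  choose P hP using fun n => hom n (homogeneousComponent n F)
    (homogeneousComponent_isHomogeneous n F)
  refine ⟨∑ n ∈ Finset.range (F.totalDegree + 1), P n, ?_⟩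
  rw [Finset.mul_sum, map_sum, Finset.sum_congr rfl fun n _ => hP n, sum_homogeneousComponent]

end STPoly

namespace STPoly

open MvPolynomial

/-- `N` bounds the derivatives of order at most two of the polynomial `P` on `K`. -/
structure BoundedOn (K : Set (E3 × ℝ)) (P : STPoly) (N : ℝ) : Prop where
  zero : ∀ p ∈ K, |ev P p| ≤ N
  one : ∀ a, ∀ p ∈ K, |ev (pderiv a P) p| ≤ N
  two : ∀ a b, ∀ p ∈ K, |ev (pderiv b (pderiv a P)) p| ≤ N

lemma pderiv_lor_mul (a : Option (Fin 3)) (P : STPoly) :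
    pderiv a (lor * P) = (2 * eta a) • (X a * P) + lor * pderiv a P := by
  rw [pderiv_mul, pderiv_lor, smul_mul_assoc]

lemma pderiv_pderiv_lor_mul (a b : Option (Fin 3)) (P : STPoly) :
    pderiv b (pderiv a (lor * P)) =
      (2 * eta a) • ((if a = b then (1 : ℝ) else 0) • P + X a * pderiv b P) +
        ((2 * eta b) • (X b * pderiv a P) + lor * pderiv b (pderiv a P)) := by
  rw [pderiv_lor_mul, map_add, pderiv_lor_mul, Derivation.map_smul, pderiv_mul]
  by_cases h : a = b
  · subst h; simp
  · simp [h, pderiv_X]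

lemma abs_eta (a : Option (Fin 3)) : |eta a| = 1 := by
  cases a <;> simp [eta]

lemma ev_euler_eq {ρ : ℝ} {F P : STPoly} (hP : box (lor * P) = F)
    {p : E3 × ℝ} (hp : p ∈ lightCone ρ) :
    4 * ev (euler P) p + 8 * ev P p = ev F p := by
  rw [← hP, box_lor_mul]
  simp [ev_lor_of_mem hp]

lemma ev_euler_pderiv_eq {ρ : ℝ} {F P : STPoly} (hP : box (lor * P) = F) (a : Option (Fin 3))
    {p : E3 × ℝ} (hp : p ∈ lightCone ρ) :
    4 * ev (euler (pderiv a P)) p + 12 * ev (pderiv a P) p =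
      ev (pderiv a F) p - 2 * eta a * (coord a p * ev (box P) p) := by
  rw [← hP, box_lor_mul, map_add, map_add, Derivation.map_smul, Derivation.map_smul, euler_pderiv,
    pderiv_lor_mul]
  simp only [ev_add, ev_mul, ev_smul, ev_lor_of_mem hp, ev_X]
  ring

section estimates

variable {ρ N : ℝ} {F P : STPoly} (hF : BoundedOn (Dcone ρ) F N) (hP : box (lor * P) = F)
include hF

lemma BoundedOn.abs_ev_box_le {p : E3 × ℝ} (hp : p ∈ Dcone ρ) : |ev (box F) p| ≤ 4 * N := by
  have h : ∀ a, |ev (pderiv a (pderiv a F)) p| ≤ N := fun a => hF.two a a p hp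
  rw [box_apply, ev_sub, ev_sum, Fin.sum_univ_three]
  have h0 := abs_le.1 (h none)
  have h1 := abs_le.1 (h (some 0))
  have h2 := abs_le.1 (h (some 1))
  have h3 := abs_le.1 (h (some 2))
  rw [abs_le]
  constructor <;> linarith

include hP

lemma abs_ev_le {p : E3 × ℝ} (hp : p ∈ lightCone ρ) : |ev P p| ≤ N := by
  have hN : 0 ≤ N := (abs_nonneg _).trans (hF.zero p (lightCone_subset_Dcone ρ hp))
  have := abs_ev_le_of_euler (P := P) (k := 2) (M := N / 4) two_pos (fun p hp => by
    have h1 := ev_euler_eq hP hp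
    have h2 := abs_le.1 (hF.zero p (lightCone_subset_Dcone ρ hp))
    push_cast
    rw [abs_le]; constructor <;> linarith) p hp
  push_cast at this
  linarith

lemma abs_ev_euler_le {p : E3 × ℝ} (hp : p ∈ lightCone ρ) : |ev (euler P) p| ≤ 3 * N := by
  have h1 := ev_euler_eq hP hp
  have h2 := abs_le.1 (hF.zero p (lightCone_subset_Dcone ρ hp))
  have h3 := abs_le.1 (abs_ev_le hF hP hp)
  rw [abs_le]; constructor <;> linarith

lemma abs_ev_box_le {p : E3 × ℝ} (hp : p ∈ lightCone ρ) : |ev (box P) p| ≤ N := by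
  have hN : 0 ≤ N := (abs_nonneg _).trans (hF.zero p (lightCone_subset_Dcone ρ hp))
  have := abs_ev_le_of_euler (P := box P) (k := 3) (M := N / 2) three_pos (fun p hp => by
    have h1 : 8 * ev (euler (box P)) p + 24 * ev (box P) p = ev (box F) p := by
      rw [← hP, box_lor_mul, map_add, map_add, map_smul, map_smul, box_euler, box_lor_mul]
      simp only [ev_add, ev_mul, ev_smul, ev_lor_of_mem hp]
      ring
    have h2 := abs_le.1 (hF.abs_ev_box_le (lightCone_subset_Dcone ρ hp))
    push_cast
    rw [abs_le]; constructor <;> linarith) p hp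
  push_cast at this
  linarith

lemma abs_source_le (a : Option (Fin 3)) {p : E3 × ℝ} (hp : p ∈ lightCone ρ) :
    |ev (pderiv a F) p - 2 * eta a * (coord a p * ev (box P) p)| ≤ (1 + 4 * ρ) * N := by
  have hD := lightCone_subset_Dcone ρ hp
  have h1 := hF.one a p hD
  have h2 : |coord a p * ev (box P) p| ≤ 2 * ρ * N := by
    rw [abs_mul]
    exact mul_le_mul (abs_coord_le_of_mem_Dcone hD a) (abs_ev_box_le hF hP hp) (abs_nonneg _)
      ((abs_nonneg _).trans (abs_coord_le_of_mem_Dcone hD a))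
  refine (abs_sub _ _).trans ?_
  rw [abs_mul (2 * eta a), abs_mul 2, abs_eta, abs_two, mul_one]
  linarith

lemma abs_ev_pderiv_le (a : Option (Fin 3)) {p : E3 × ℝ} (hp : p ∈ lightCone ρ) :
    |ev (pderiv a P) p| ≤ (1 + 4 * ρ) * N := by
  have h0 := (abs_nonneg _).trans (abs_source_le hF hP a hp)
  have := abs_ev_le_of_euler (P := pderiv a P) (k := 3) (M := (1 + 4 * ρ) * N) three_pos
    (fun p hp => by
    have h1 := ev_euler_pderiv_eq hP a hp
    have h2 := abs_le.1 (abs_source_le hF hP a hp)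
    push_cast
    rw [abs_le]; constructor <;> linarith) p hp
  push_cast at this
  linarith

lemma abs_ev_euler_pderiv_le (a : Option (Fin 3)) {p : E3 × ℝ} (hp : p ∈ lightCone ρ) :
    |ev (euler (pderiv a P)) p| ≤ 4 * ((1 + 4 * ρ) * N) := by
  have h1 := ev_euler_pderiv_eq hP a hp
  have h2 := abs_le.1 (abs_source_le hF hP a hp)
  have h3 := abs_le.1 (abs_ev_pderiv_le hF hP a hp)
  rw [abs_le]; constructor <;> linarith

lemma boundedOn_lor_mul (hρ : 0 < ρ) :
    BoundedOn (interior (Dcone ρ)) (lor * P) ((8 + 48 * ρ * (1 + 4 * ρ) + ρ ^ 2) * N) := by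
  have hmem : ((0 : E3), ρ) ∈ Dcone ρ := interior_subset (mem_interior_Dcone.2
    (by simp; constructor <;> linarith))
  have hN : 0 ≤ N := (abs_nonneg _).trans (hF.zero _ hmem)
  have hlin : ∀ (a b : Option (Fin 3)) {p : E3 × ℝ}, p ∈ lightCone ρ →
      |2 * eta a * (coord a p * (2 * ev (pderiv b P) p + ev (euler (pderiv b P)) p))| ≤
        24 * ρ * (1 + 4 * ρ) * N := by
    intro a b p hp
    have h1 := abs_le.1 (abs_ev_pderiv_le hF hP b hp)
    have h2 := abs_le.1 (abs_ev_euler_pderiv_le hF hP b hp)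
    have h3 : |2 * ev (pderiv b P) p + ev (euler (pderiv b P)) p| ≤ 6 * ((1 + 4 * ρ) * N) := by
      rw [abs_le]; constructor <;> linarith
    have h4 := mul_le_mul (abs_coord_le_of_mem_Dcone (lightCone_subset_Dcone ρ hp) a) h3
      (abs_nonneg _) (by positivity)
    rw [abs_mul, abs_mul 2, abs_eta, abs_mul]
    norm_num
    linarith
  refine ⟨fun p hp => ?_, fun a p hp => ?_, fun a b p hp => ?_⟩
  · have := abs_ev_le_of_data (A := N) (B := 0) (P := lor * P) hρ (by rw [hP]; exact hF.zero)
      (fun p hp => by rw [lor_mul_data P hp, abs_zero]) p hp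
    refine this.trans ?_
    have : 0 ≤ (8 + 48 * ρ * (1 + 4 * ρ)) * N := by positivity
    linarith
  · have := abs_ev_le_of_data (A := N) (B := 20 * ρ * N) (P := pderiv a (lor * P)) hρ
      (by rw [box_comm, hP]; exact hF.one a) (fun p hp => by
        have h1 : ev (pderiv a (lor * P) + euler (pderiv a (lor * P))) p =
            2 * eta a * (coord a p * (2 * ev P p + ev (euler P) p)) := by
          rw [pderiv_lor_mul]
          simp only [map_add, map_smul, euler_mul, euler_X, euler_lor, ev_add, ev_mul, ev_smul,
            ev_X, ev_lor_of_mem hp]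
          ring
        have h2 := abs_le.1 (abs_ev_le hF hP hp)
        have h3 := abs_le.1 (abs_ev_euler_le hF hP hp)
        have h4 : |2 * ev P p + ev (euler P) p| ≤ 5 * N := by
          rw [abs_le]; constructor <;> linarith
        have h5 := mul_le_mul (abs_coord_le_of_mem_Dcone (lightCone_subset_Dcone ρ hp) a) h4
          (abs_nonneg _) (by positivity)
        rw [h1, abs_mul, abs_mul 2, abs_eta, abs_mul]
        norm_num
        linarith) p hp
    refine this.trans ?_
    have : 0 ≤ (8 + 28 * ρ + 192 * ρ ^ 2) * N := by positivity
    linarith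
  · have := abs_ev_le_of_data (A := N) (B := (8 + 48 * ρ * (1 + 4 * ρ)) * N)
      (P := pderiv b (pderiv a (lor * P))) hρ
      (by rw [box_comm, box_comm, hP]; exact hF.two a b) (fun p hp => by
        have h1 : ev (pderiv b (pderiv a (lor * P)) + euler (pderiv b (pderiv a (lor * P)))) p =
            2 * eta a * ((if a = b then (1 : ℝ) else 0) * (ev P p + ev (euler P) p)) +
            (2 * eta a * (coord a p * (2 * ev (pderiv b P) p + ev (euler (pderiv b P)) p)) +
            2 * eta b * (coord b p * (2 * ev (pderiv a P) p + ev (euler (pderiv a P)) p))) := by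
          rw [pderiv_pderiv_lor_mul]
          simp only [map_add, map_smul, euler_mul, euler_X, euler_lor, ev_add, ev_mul, ev_smul,
            ev_X, ev_lor_of_mem hp]
          ring
        have h2 : |2 * eta a * ((if a = b then (1 : ℝ) else 0) * (ev P p + ev (euler P) p))| ≤
            8 * N := by
          have h3 := abs_le.1 (abs_ev_le hF hP hp)
          have h4 := abs_le.1 (abs_ev_euler_le hF hP hp)
          have h5 : |ev P p + ev (euler P) p| ≤ 4 * N := by
            rw [abs_le]; constructor <;> linarith
          rw [abs_mul, abs_mul 2, abs_eta, abs_mul]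
          split_ifs
          · norm_num
            linarith
          · norm_num
            exact hN
        have h3 := abs_le.1 (hlin a b hp)
        have h4 := abs_le.1 (hlin b a hp)
        have h5 := abs_le.1 h2
        rw [h1, abs_le]
        constructor <;> linarith) p hp
    refine this.trans (le_of_eq ?_)
    ring

end estimates

end STPoly

/-- A function smooth near a compact set agrees near it with a globally smooth function of compact
support. -/
lemma exists_contDiff_hasCompactSupport {G : Type*} [NormedAddCommGroup G] [NormedSpace ℝ G]
    [FiniteDimensional ℝ G] {n : ℕ} {K V : Set G} (hK : IsCompact K) (hV : IsOpen V)
    (hKV : K ⊆ V) {f : G → ℝ} (hf : ContDiffOn ℝ n f V) :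
    ∃ g : G → ℝ, ContDiff ℝ n g ∧ HasCompactSupport g ∧ ∀ x ∈ K, g =ᶠ[nhds x] f := by
  obtain ⟨t, ht, hKt, htV⟩ := exists_compact_between hK hV hKV
  obtain ⟨χ, h1, h0, -⟩ := exists_contMDiffMap_one_nhds_of_subset_interior
    (modelWithCornersSelf ℝ G) (n := n) hK.isClosed hKt
  have hχ : ContDiff ℝ n χ := contMDiff_iff_contDiff.1 χ.contMDiff
  refine ⟨fun x => χ x * f x, ?_, ?_, ?_⟩
  · rw [contDiff_iff_contDiffAt]
    intro x
    by_cases hx : x ∈ V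
    · exact hχ.contDiffAt.mul (hf.contDiffAt (hV.mem_nhds hx))
    · have hxt : tᶜ ∈ nhds x := ht.isClosed.isOpen_compl.mem_nhds fun h => hx (htV h)
      refine (contDiffAt_const (c := (0 : ℝ))).congr_of_eventuallyEq ?_
      filter_upwards [hxt] with y hy
      rw [h0 y hy, zero_mul]
  · exact HasCompactSupport.intro ht fun x hx => by rw [h0 x hx, zero_mul]
  · intro x hx
    filter_upwards [h1.filter_mono (nhds_le_nhdsSet hx)] with y hy
    rw [hy, one_mul]

instance : (volume : Measure (E3 × ℝ)).IsAddHaarMeasure :=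
  inferInstanceAs (Measure.IsAddHaarMeasure ((volume : Measure E3).prod (volume : Measure ℝ)))

/-- The squared Euclidean length on `ℝ³ × ℝ`. -/
def nsq (p : E3 × ℝ) : ℝ := ∑ a, coord a p ^ 2

lemma continuous_nsq : Continuous nsq := by unfold nsq; fun_prop

lemma nsq_eq (p : E3 × ℝ) : nsq p = p.2 ^ 2 + ‖p.1‖ ^ 2 := by
  rw [EuclideanSpace.real_norm_sq_eq]
  simp [nsq]

lemma norm_sq_le_nsq (p : E3 × ℝ) : ‖p‖ ^ 2 ≤ nsq p := by
  rw [nsq_eq, Prod.norm_def]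
  rcases max_choice ‖p.1‖ ‖p.2‖ with h | h <;> rw [h]
  · nlinarith [sq_nonneg p.2]
  · rw [norm_eq_abs, sq_abs]; nlinarith [sq_nonneg ‖p.1‖]

lemma nsq_le (p : E3 × ℝ) : nsq p ≤ 2 * ‖p‖ ^ 2 := by
  rw [nsq_eq]
  have h1 := pow_le_pow_left₀ (norm_nonneg _) (norm_fst_le p) 2
  have h2 := pow_le_pow_left₀ (norm_nonneg _) (norm_snd_le p) 2
  rw [norm_eq_abs p.2, sq_abs] at h2
  linarith

lemma nsq_sub (p y : E3 × ℝ) : nsq (p - y) = nsq p - 2 * ∑ a, coord a p * coord a y + nsq y := by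
  simp only [nsq, map_sub, Finset.mul_sum, ← Finset.sum_sub_distrib, ← Finset.sum_add_distrib]
  exact Finset.sum_congr rfl fun a _ => by ring

/-- Convolution with the polynomial kernel `(1 - |z|²/M)ⁿ`. -/
def kconv (M : ℝ) (n : ℕ) (f : E3 × ℝ → ℝ) (p : E3 × ℝ) : ℝ :=
  ∫ z, (1 - nsq z / M) ^ n * f (p - z)

lemma kconv_eq (M : ℝ) (n : ℕ) (f : E3 × ℝ → ℝ) (p : E3 × ℝ) :
    kconv M n f p = ∫ y, (1 - nsq (p - y) / M) ^ n * f y := by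
  rw [kconv, ← integral_sub_left_eq_self _ volume p]
  simp

open MvPolynomial in
lemma exists_ev_eq_kconv (M : ℝ) (n : ℕ) : ∀ {f : E3 × ℝ → ℝ}, Continuous f →
    HasCompactSupport f → ∃ P : STPoly, ∀ p, P.ev p = kconv M n f p := by
  simp only [kconv_eq]
  induction n with
  | zero =>
    intro f _ _
    exact ⟨C (∫ y, f y), fun p => by simp⟩
  | succ n ih =>
    intro f hf hfc
    have hN := continuous_nsq
    obtain ⟨P, hP⟩ := ih (f := fun y => (1 - nsq y / M) * f y) (by fun_prop) hfc.mul_left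
    obtain ⟨R, hR⟩ := ih hf hfc
    choose S hS using fun a => ih (f := fun y => coord a y * f y) (by fun_prop) hfc.mul_left
    refine ⟨P - (1 / M) • ((∑ a, X a * X a) * R) + (2 / M) • ∑ a, X a * S a, fun p => ?_⟩
    have int : ∀ {g : E3 × ℝ → ℝ}, Continuous g → HasCompactSupport g →
        Integrable fun y => (1 - nsq (p - y) / M) ^ n * g y := fun hg hgc =>
      Continuous.integrable_of_hasCompactSupport (by fun_prop) hgc.mul_left
    have e : ∀ y, (1 - nsq (p - y) / M) ^ (n + 1) * f y =
        (1 - nsq (p - y) / M) ^ n * ((1 - nsq y / M) * f y)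
        - nsq p / M * ((1 - nsq (p - y) / M) ^ n * f y)
        + ∑ a, (2 / M * coord a p) * ((1 - nsq (p - y) / M) ^ n * (coord a y * f y)) := by
      intro y
      have e1 : ∑ a, (2 / M * coord a p) * ((1 - nsq (p - y) / M) ^ n * (coord a y * f y)) =
          2 / M * ((1 - nsq (p - y) / M) ^ n * f y) * ∑ a, coord a p * coord a y := by
        rw [Finset.mul_sum]
        exact Finset.sum_congr rfl fun a _ => by ring
      rw [e1, pow_succ, nsq_sub]
      ring
    have i1 := int (g := fun y => (1 - nsq y / M) * f y) (by fun_prop) hfc.mul_left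
    have i2 := (int hf hfc).const_mul (nsq p / M)
    have i3 : ∀ a, Integrable fun y =>
        (2 / M * coord a p) * ((1 - nsq (p - y) / M) ^ n * (coord a y * f y)) := fun a =>
      (int (g := fun y => coord a y * f y) (by fun_prop) hfc.mul_left).const_mul _
    have i12 : Integrable fun y => (1 - nsq (p - y) / M) ^ n * ((1 - nsq y / M) * f y) -
        nsq p / M * ((1 - nsq (p - y) / M) ^ n * f y) := i1.sub i2
    simp only [e]
    rw [integral_add i12 (integrable_finsetSum _ fun a _ => i3 a), integral_sub i1 i2,
      integral_finsetSum _ fun a _ => i3 a]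
    simp only [integral_const_mul, ← hP, ← hR, ← hS, STPoly.ev_add, STPoly.ev_sub, STPoly.ev_smul,
      STPoly.ev_mul, STPoly.ev_sum, STPoly.ev_X, Finset.mul_sum]
    congr 1
    · rw [nsq]
      simp only [sq]
      ring
    · exact Finset.sum_congr rfl fun a _ => by ring

lemma fderiv_kconv (M : ℝ) (n : ℕ) {f : E3 × ℝ → ℝ} (hf : ContDiff ℝ 1 f)
    (hfc : HasCompactSupport f) (p v : E3 × ℝ) :
    fderiv ℝ (kconv M n f) p v = kconv M n (fun y => fderiv ℝ f y v) p := by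
  have hN := continuous_nsq
  have hk : Continuous fun z => (1 - nsq z / M) ^ n := by fun_prop
  have h := hfc.hasFDerivAt_convolution_right (μ := volume) (ContinuousLinearMap.mul ℝ ℝ)
    hk.locallyIntegrable hf p
  have h' : HasFDerivAt (kconv M n f) _ p := h
  rw [h'.fderiv, convolution_def, ContinuousLinearMap.integral_apply]
  · rfl
  · exact ((hfc.fderiv ℝ).convolutionExists_right _ hk.locallyIntegrable
      (hf.continuous_fderiv one_ne_zero)) p

lemma tendsto_kconv {R : ℝ} (hR : 0 < R) {f : E3 × ℝ → ℝ} (hf : Continuous f)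
    (hfR : Function.support f ⊆ closedBall 0 R) {ε : ℝ} (hε : 0 < ε) :
    ∀ᶠ n in Filter.atTop, ∀ p ∈ closedBall (0 : E3 × ℝ) R,
      |(∫ z in {z | nsq z ≤ 9 * R ^ 2}, (1 - nsq z / (9 * R ^ 2)) ^ n)⁻¹ *
        kconv (9 * R ^ 2) n f p - f p| ≤ ε := by
  set M := 9 * R ^ 2 with hM
  have hM0 : 0 < M := by positivity
  set s : Set (E3 × ℝ) := {z | nsq z ≤ M} with hs
  have hN := continuous_nsq
  have hsc : IsCompact s := by
    refine (isCompact_closedBall (0 : E3 × ℝ) (3 * R)).of_isClosed_subset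
      (isClosed_le hN continuous_const) fun z hz => ?_
    rw [mem_closedBall_zero_iff]
    refine le_of_sq_le_sq ?_ (by positivity)
    have := norm_sq_le_nsq z
    have hz' : nsq z ≤ M := hz
    rw [mul_pow]; linarith
  have hfc : HasCompactSupport f := HasCompactSupport.of_support_subset_isCompact
    (isCompact_closedBall 0 R) hfR
  obtain ⟨C, hC⟩ := hf.bounded_above_of_compact_support hfc
  have hC0 : 0 ≤ C := (norm_nonneg _).trans (hC 0)
  obtain ⟨δ, hδ, hu⟩ := Metric.uniformContinuous_iff.1
    (hfc.uniformContinuous_of_continuous hf) (ε / 2) (by positivity)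
  have hbd : ∀ p z, |f (p - z) - f p| ≤ ε / 2 + 2 * C / δ * ‖z‖ := by
    intro p z
    by_cases hz : ‖z‖ < δ
    · have := hu (a := p - z) (b := p) (by simpa [dist_eq_norm] using hz)
      rw [Real.dist_eq] at this
      have : 0 ≤ 2 * C / δ * ‖z‖ := by positivity
      linarith
    · have h1 := hC (p - z)
      have h2 := hC p
      rw [norm_eq_abs] at h1 h2
      have h3 : 2 * C ≤ 2 * C / δ * ‖z‖ := by
        rw [div_mul_eq_mul_div, le_div_iff₀ hδ]
        exact mul_le_mul_of_nonneg_left (not_lt.1 hz) (by positivity)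
      linarith [abs_sub (f (p - z)) (f p)]
  have hpeak := tendsto_setIntegral_pow_smul_of_unique_maximum_of_isCompact_of_continuousOn
    (μ := (volume : Measure (E3 × ℝ))) hsc (c := fun z => 1 - nsq z / M) (x₀ := 0)
    (g := fun z => ε / 2 + 2 * C / δ * ‖z‖) (by fun_prop)
    (fun y _ hy => by
      have h1 := norm_sq_le_nsq y
      have h2 : 0 < ‖y‖ ^ 2 := by positivity
      have h3 : 0 < nsq y / M := div_pos (by linarith) hM0
      have h4 : nsq (0 : E3 × ℝ) = 0 := by simp [nsq]
      rw [h4]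
      simp only [zero_div, sub_zero]
      linarith)
    (fun x hx => by
      have : nsq x / M ≤ 1 := (div_le_one hM0).2 hx
      linarith)
    (by simp [nsq])
    (by
      apply subset_closure
      refine mem_interior.2 ⟨{z | nsq z < M}, fun z hz => show nsq z ≤ M from le_of_lt hz,
        isOpen_lt hN continuous_const, ?_⟩
      simpa [nsq] using hM0)
    (by fun_prop)
  simp only [norm_zero, mul_zero, add_zero, smul_eq_mul] at hpeak
  filter_upwards [hpeak.eventually_lt_const (show ε / 2 < ε by linarith)] with n hn p hp
  set k : E3 × ℝ → ℝ := fun z => (1 - nsq z / M) ^ n with hk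
  have hkc : Continuous k := by fun_prop
  have hk0 : ∀ z ∈ s, 0 ≤ k z := fun z hz => by
    have : nsq z / M ≤ 1 := (div_le_one hM0).2 hz
    exact pow_nonneg (by linarith) _
  have hkpos : 0 < ∫ z in s, k z := by
    rw [setIntegral_pos_iff_support_of_nonneg_ae]
    · have hsub : {z | nsq z < M} ⊆ Function.support k ∩ s := fun z hz => by
        refine ⟨?_, show nsq z ≤ M from le_of_lt hz⟩
        have h1 : nsq z / M < 1 := (div_lt_one hM0).2 hz
        exact (pow_pos (by linarith) _).ne'
      refine lt_of_lt_of_le ?_ (measure_mono hsub)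
      exact (isOpen_lt hN continuous_const).measure_pos _ ⟨0, by simpa [nsq] using hM0⟩
    · exact (ae_restrict_iff' hsc.measurableSet).2 (Filter.Eventually.of_forall hk0)
    · exact hkc.continuousOn.integrableOn_compact hsc
  have hconv : kconv M n f p = ∫ z in s, k z * f (p - z) := by
    rw [kconv, setIntegral_eq_integral_of_forall_compl_eq_zero]
    intro z hz
    have : f (p - z) = 0 := by
      by_contra hne
      have h1 := hfR hne
      rw [mem_closedBall_zero_iff] at h1 hp
      have h2 : ‖z‖ ≤ 2 * R := by
        have : z = p - (p - z) := by abel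
        rw [this]
        exact (norm_sub_le _ _).trans (by linarith)
      have h3 := pow_le_pow_left₀ (norm_nonneg z) h2 2
      have h4 := nsq_le z
      exact hz (show nsq z ≤ M by nlinarith)
    rw [this, mul_zero]
  have i1 : IntegrableOn (fun z => k z * f (p - z)) s :=
    ContinuousOn.integrableOn_compact hsc (by fun_prop)
  have i2 : IntegrableOn (fun z => k z * f p) s :=
    ContinuousOn.integrableOn_compact hsc (by fun_prop)
  have i3 : IntegrableOn (fun z => k z * (ε / 2 + 2 * C / δ * ‖z‖)) s :=
    ContinuousOn.integrableOn_compact hsc (by fun_prop)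
  have e1 : (∫ z in s, k z)⁻¹ * kconv M n f p - f p =
      (∫ z in s, k z)⁻¹ * ∫ z in s, (k z * f (p - z) - k z * f p) := by
    rw [integral_sub i1 i2, hconv, integral_mul_const, mul_sub, ← mul_assoc _ _ (f p),
      inv_mul_cancel₀ hkpos.ne', one_mul]
  have e2 : |∫ z in s, (k z * f (p - z) - k z * f p)| ≤
      ∫ z in s, k z * (ε / 2 + 2 * C / δ * ‖z‖) := by
    rw [← norm_eq_abs]
    refine norm_integral_le_of_norm_le i3 ((ae_restrict_iff' hsc.measurableSet).2
      (Filter.Eventually.of_forall fun z hz => ?_))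
    rw [← mul_sub, norm_mul, norm_eq_abs, norm_eq_abs, abs_of_nonneg (hk0 z hz)]
    exact mul_le_mul_of_nonneg_left (hbd p z) (hk0 z hz)
  rw [e1, abs_mul, abs_of_pos (inv_pos.2 hkpos)]
  exact (mul_le_mul_of_nonneg_left e2 (inv_pos.2 hkpos).le).trans hn.le

open MvPolynomial in
/-- Polynomials approximate functions in the `C²` sense on compact sets. -/
lemma exists_ev_approx {K V : Set (E3 × ℝ)} (hK : IsCompact K) (hV : IsOpen V) (hKV : K ⊆ V)
    {Φ : E3 × ℝ → ℝ} (hΦ : ContDiffOn ℝ 2 Φ V) {ε : ℝ} (hε : 0 < ε) :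
    ∃ P : STPoly, ∀ p ∈ K, |P.ev p - Φ p| ≤ ε ∧
      (∀ a, |STPoly.ev (pderiv a P) p - fderiv ℝ Φ p (cvec a)| ≤ ε) ∧
      ∀ a b, |STPoly.ev (pderiv b (pderiv a P)) p -
        fderiv ℝ (fderiv ℝ Φ) p (cvec b) (cvec a)| ≤ ε := by
  obtain ⟨f, hf, hfc, hfΦ⟩ := exists_contDiff_hasCompactSupport (n := 2) hK hV hKV hΦ
  have hf : ContDiff ℝ 2 f := hf
  obtain ⟨R, hR, hsub⟩ := (hfc.isCompact.union hK).isBounded.subset_closedBall_lt 0 0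
  have hKR : K ⊆ closedBall 0 R := subset_union_right.trans hsub
  have hfR : tsupport f ⊆ closedBall 0 R := subset_union_left.trans hsub
  set f1 : Option (Fin 3) → E3 × ℝ → ℝ := fun a y => fderiv ℝ f y (cvec a) with hf1
  set f2 : Option (Fin 3) → Option (Fin 3) → E3 × ℝ → ℝ :=
    fun a b y => fderiv ℝ (f1 a) y (cvec b) with hf2
  have hdf : ContDiff ℝ 1 (fderiv ℝ f) := hf.fderiv_right (by norm_num)
  have c1 : ∀ a, ContDiff ℝ 1 (f1 a) := fun a => hdf.clm_apply contDiff_const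
  have c2 : ∀ a b, Continuous (f2 a b) := fun a b =>
    ((c1 a).continuous_fderiv one_ne_zero).clm_apply continuous_const
  have t1 : ∀ a, tsupport (f1 a) ⊆ tsupport f := fun a => by
    refine closure_minimal (fun x hx => ?_) (isClosed_tsupport f)
    by_contra hne
    apply hx
    have : fderiv ℝ f x = 0 := by
      by_contra h; exact hne (support_fderiv_subset ℝ h)
    simp [hf1, this]
  have t2 : ∀ a b, tsupport (f2 a b) ⊆ tsupport f := fun a b => by
    refine (closure_minimal (fun x hx => ?_) (isClosed_tsupport (f1 a))).trans (t1 a)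
    by_contra hne
    apply hx
    have : fderiv ℝ (f1 a) x = 0 := by
      by_contra h; exact hne (support_fderiv_subset ℝ h)
    simp [hf2, this]
  have k1 : ∀ a, HasCompactSupport (f1 a) := fun a =>
    hfc.of_isClosed_subset (isClosed_tsupport _) (t1 a)
  have ev0 := tendsto_kconv hR hf.continuous ((subset_tsupport f).trans hfR) hε
  have ev1 : ∀ a, _ := fun a => tendsto_kconv hR (c1 a).continuous
    ((subset_tsupport (f1 a)).trans ((t1 a).trans hfR)) hε
  have ev2 : ∀ a b, _ := fun a b => tendsto_kconv hR (c2 a b)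
    ((subset_tsupport (f2 a b)).trans ((t2 a b).trans hfR)) hε
  obtain ⟨n, h0, h1, h2⟩ := (ev0.and ((Filter.eventually_all.2 ev1).and
    (Filter.eventually_all.2 fun a => Filter.eventually_all.2 (ev2 a)))).exists
  set c := (∫ z in {z | nsq z ≤ 9 * R ^ 2}, (1 - nsq z / (9 * R ^ 2)) ^ n)⁻¹
  obtain ⟨P, hP⟩ := exists_ev_eq_kconv (9 * R ^ 2) n hf.continuous hfc
  have hPf : P.ev = kconv (9 * R ^ 2) n f := funext hP
  have d : ∀ (Q : STPoly) a p, STPoly.ev (pderiv a Q) p = fderiv ℝ Q.ev p (cvec a) := by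
    intro Q a p
    rw [STPoly.fderiv_ev]
    simp [-Fintype.sum_option, coord_cvec]
  have hP1 : ∀ a, STPoly.ev (pderiv a P) = kconv (9 * R ^ 2) n (f1 a) := by
    intro a
    ext p
    rw [d, hPf, fderiv_kconv _ _ (hf.of_le one_le_two) hfc]
  have hP2 : ∀ a b, STPoly.ev (pderiv b (pderiv a P)) = kconv (9 * R ^ 2) n (f2 a b) := by
    intro a b
    ext p
    rw [d, hP1, fderiv_kconv _ _ (c1 a) (k1 a)]
  refine ⟨c • P, fun p hp => ⟨?_, fun a => ?_, fun a b => ?_⟩⟩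
  · rw [STPoly.ev_smul, hPf, ← (hfΦ p hp).self_of_nhds]
    exact h0 p (hKR hp)
  · rw [Derivation.map_smul, STPoly.ev_smul, hP1, ← (hfΦ p hp).fderiv_eq]
    exact h1 a p (hKR hp)
  · rw [Derivation.map_smul, Derivation.map_smul, STPoly.ev_smul, hP2,
      ← (hfΦ p hp).fderiv.fderiv_eq]
    have : fderiv ℝ (fderiv ℝ f) p (cvec b) (cvec a) = f2 a b p := by
      have h := (hdf.differentiable one_ne_zero p).hasFDerivAt.clm_apply
        (hasFDerivAt_const (cvec a) p)
      change _ = fderiv ℝ (f1 a) p (cvec b)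
      rw [h.fderiv]
      simp
    rw [this]
    exact h2 a b p (hKR hp)

lemma wave_sub {V : Set (E3 × ℝ)} (hV : IsOpen V) {U W : E3 × ℝ → ℝ} (hU : ContDiffOn ℝ 2 U V)
    (hW : ContDiffOn ℝ 2 W V) {p : E3 × ℝ} (hp : p ∈ V) :
    wave (fun q => U q - W q) p = wave U p - wave W p := by
  have hn := hV.mem_nhds hp
  have hdU : DifferentiableAt ℝ (fderiv ℝ U) p :=
    ((hU.contDiffAt hn).fderiv_right (m := 1) (by norm_num)).differentiableAt one_ne_zero
  have hdW : DifferentiableAt ℝ (fderiv ℝ W) p :=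
    ((hW.contDiffAt hn).fderiv_right (m := 1) (by norm_num)).differentiableAt one_ne_zero
  have h1 : fderiv ℝ (fun q => U q - W q) =ᶠ[nhds p] fun q => fderiv ℝ U q - fderiv ℝ W q := by
    filter_upwards [hn] with q hq
    exact fderiv_fun_sub ((hU.contDiffAt (hV.mem_nhds hq)).differentiableAt two_ne_zero)
      ((hW.contDiffAt (hV.mem_nhds hq)).differentiableAt two_ne_zero)
  simp only [wave, h1.fderiv_eq, fderiv_fun_sub hdU hdW, _root_.sub_apply, Finset.sum_sub_distrib]
  ring

lemma abs_le_of_vanishing {ρ A : ℝ} {u : E3 × ℝ → ℝ} (hu : ContDiffOn ℝ 2 u (Dcone ρ))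
    (h0 : ∀ x : E3, ‖x‖ ≤ ρ → u (x, ‖x‖) = 0)
    (hA : ∀ p ∈ interior (Dcone ρ), |wave u p| ≤ A) :
    ∀ p ∈ interior (Dcone ρ), |u p| ≤ ρ ^ 2 * A := by
  have h : ∀ x : E3, ‖x‖ < ρ → fderivWithin ℝ u (Dcone ρ) (x, ‖x‖) (x, ‖x‖) = 0 := by
    intro x hx
    have hγ : HasDerivWithinAt (fun σ : ℝ => σ • ((x, ‖x‖) : E3 × ℝ)) (x, ‖x‖) (Icc 0 1) 1 := by
      simpa using ((hasDerivAt_id (1 : ℝ)).smul_const ((x, ‖x‖) : E3 × ℝ)).hasDerivWithinAt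
    have hσ : ∀ σ ∈ Icc (0 : ℝ) 1, σ • ((x, ‖x‖) : E3 × ℝ) = (σ • x, ‖σ • x‖) ∧ ‖σ • x‖ ≤ ρ := by
      intro σ hσ
      rw [norm_smul, norm_of_nonneg hσ.1]
      exact ⟨by simp, by nlinarith [norm_nonneg x, hσ.1, hσ.2]⟩
    have hmaps : MapsTo (fun σ : ℝ => σ • ((x, ‖x‖) : E3 × ℝ)) (Icc 0 1) (Dcone ρ) := by
      intro σ hs
      obtain ⟨h1, h2⟩ := hσ σ hs
      simp only [h1]
      exact ⟨h2, le_rfl, by simp only; linarith⟩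
    have hxD : ((x, ‖x‖) : E3 × ℝ) ∈ Dcone ρ := ⟨hx.le, le_rfl, by simp only; linarith⟩
    have hd := ((hu.differentiableOn two_ne_zero) _ hxD).hasFDerivWithinAt
    have h1 := hd.comp_hasDerivWithinAt_of_eq (1 : ℝ) hγ hmaps (by simp)
    have h2 : HasDerivWithinAt (u ∘ fun σ : ℝ => σ • ((x, ‖x‖) : E3 × ℝ)) 0 (Icc 0 1) 1 := by
      refine (hasDerivWithinAt_const (1 : ℝ) (Icc 0 1) (0 : ℝ)).congr_of_mem (fun σ hs => ?_)
        (right_mem_Icc.2 zero_le_one)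
      obtain ⟨h1, h2⟩ := hσ σ hs
      simp only [Function.comp_apply, h1]
      exact h0 _ h2
    exact (uniqueDiffOn_Icc zero_lt_one 1 (right_mem_Icc.2 zero_le_one)).eq_deriv _ h1 h2
  intro p hp
  have := abs_le_of_cone_data hu hA (B := 0) (fun x hx => by rw [h x hx, h0 x hx.le]; simp) p hp
  linarith

section Approximation

variable {G : Type*} [NormedAddCommGroup G] [NormedSpace ℝ G]

lemma abs_sub_le_of_abs_fderiv_le {V : Set G} (hV : Convex ℝ V) {v : G → ℝ}
    (hv : Differentiable ℝ v) {e : G} {N : ℝ} (h : ∀ q ∈ V, |fderiv ℝ v q e| ≤ N) {p : G} {t : ℝ}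
    (hp : p ∈ V) (hpt : p + t • e ∈ V) : |v (p + t • e) - v p| ≤ N * |t| := by
  have hd : ∀ s ∈ Icc (0 : ℝ) 1, HasDerivWithinAt (fun s : ℝ => v (p + s • (t • e)))
      (fderiv ℝ v (p + s • (t • e)) (t • e)) (Icc 0 1) s := by
    intro s _
    have h1 : HasDerivAt (fun s : ℝ => p + s • (t • e)) (t • e) s := by
      simpa using ((hasDerivAt_id s).smul_const (t • e)).const_add p
    exact ((hv _).hasFDerivAt.comp_hasDerivAt s h1).hasDerivWithinAt
  have := norm_image_sub_le_of_norm_deriv_le_segment_01' (C := N * |t|) hd fun s hs => by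
    rw [map_smul, norm_smul, norm_eq_abs, norm_eq_abs, mul_comm]
    exact mul_le_mul_of_nonneg_right (h _ (hV.add_smul_mem hp hpt ⟨hs.1, hs.2.le⟩)) (abs_nonneg _)
  simpa using this

lemma abs_sub_le_of_approx {V : Set G} (hV : Convex ℝ V) {w : G → ℝ} {e : G} {N : ℝ}
    (h : ∀ ε > 0, ∃ v : G → ℝ, Differentiable ℝ v ∧
      ∀ q ∈ V, |w q - v q| ≤ ε ∧ |fderiv ℝ v q e| ≤ N + ε) {p : G} {t : ℝ}
    (hp : p ∈ V) (hpt : p + t • e ∈ V) : |w (p + t • e) - w p| ≤ N * |t| := by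
  refine le_of_forall_pos_le_add fun ε hε => ?_
  obtain ⟨v, hv, hb⟩ := h (ε / (2 + |t|)) (by positivity)
  have h1 := abs_sub_le_of_abs_fderiv_le hV hv (fun q hq => (hb q hq).2) hp hpt
  have h2 := (hb _ hp).1
  have h3 := (hb _ hpt).1
  have h4 : ε / (2 + |t|) * (2 + |t|) = ε := div_mul_cancel₀ _ (by positivity)
  rw [abs_le] at *
  constructor <;> nlinarith

lemma abs_fderiv_le_of_abs_sub_le {w : G → ℝ} {p e : G} (hw : DifferentiableAt ℝ w p) {N : ℝ}
    (hN : 0 ≤ N) (h : ∀ᶠ t in nhds (0 : ℝ), |w (p + t • e) - w p| ≤ N * |t|) :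
    |fderiv ℝ w p e| ≤ N := by
  have h1 : HasDerivAt (fun t : ℝ => w (p + t • e)) (fderiv ℝ w p e) 0 :=
    hw.hasFDerivAt.hasLineDerivAt e
  exact h1.le_of_lip' hN (by simpa using h)

lemma eventually_add_smul_mem {V : Set G} (hV : IsOpen V) {p : G} (hp : p ∈ V) (e : G) :
    ∀ᶠ t in nhds (0 : ℝ), p + t • e ∈ V := by
  have : ContinuousAt (fun t : ℝ => p + t • e) 0 := by fun_prop
  exact this.eventually_mem (by simpa using hV.mem_nhds hp)

lemma abs_fderiv_le_of_approx {V : Set G} (hV : Convex ℝ V) (hVo : IsOpen V) {w : G → ℝ} {e : G}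
    {N : ℝ} (hN : 0 ≤ N) (h : ∀ ε > 0, ∃ v : G → ℝ, Differentiable ℝ v ∧
      ∀ q ∈ V, |w q - v q| ≤ ε ∧ |fderiv ℝ v q e| ≤ N + ε) {p : G}
    (hp : p ∈ V) (hw : DifferentiableAt ℝ w p) : |fderiv ℝ w p e| ≤ N :=
  abs_fderiv_le_of_abs_sub_le hw hN ((eventually_add_smul_mem hVo hp e).mono fun _ ht =>
    abs_sub_le_of_approx hV h hp ht)

lemma abs_fderiv_fderiv_le_of_approx {V : Set G} (hV : Convex ℝ V) (hVo : IsOpen V) {w : G → ℝ}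
    (hw : ContDiffOn ℝ 2 w V) {a b : G} {N : ℝ} (hN : 0 ≤ N)
    (h : ∀ ε > 0, ∃ v : G → ℝ, ContDiff ℝ 2 v ∧
      ∀ q ∈ V, |w q - v q| ≤ ε ∧ |fderiv ℝ (fderiv ℝ v) q a b| ≤ N + ε) {p : G} (hp : p ∈ V) :
    |fderiv ℝ (fderiv ℝ w) p a b| ≤ N := by
  have hdw : DifferentiableAt ℝ (fderiv ℝ w) p :=
    ((hw.contDiffAt (hVo.mem_nhds hp)).fderiv_right (m := 1) (by norm_num)).differentiableAt
      one_ne_zero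
  have happ : ∀ {f : G → ℝ} {q : G}, DifferentiableAt ℝ (fderiv ℝ f) q →
      HasFDerivAt (fun y => fderiv ℝ f y b) ((fderiv ℝ (fderiv ℝ f) q).flip b) q := by
    intro f q hf
    simpa using hf.hasFDerivAt.clm_apply (hasFDerivAt_const b q)
  have hdiff : ∀ q ∈ V, DifferentiableAt ℝ w q := fun q hq =>
    (hw.contDiffAt (hVo.mem_nhds hq)).differentiableAt two_ne_zero
  have key : |fderiv ℝ (fun y => fderiv ℝ w y b) p a| ≤ N := by
    refine abs_fderiv_le_of_abs_sub_le (happ hdw).differentiableAt hN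
      ((eventually_add_smul_mem hVo hp a).mono fun t ht => ?_)
    have hshift : ∀ {f : G → ℝ} {q : G}, DifferentiableAt ℝ f q → DifferentiableAt ℝ f (q + t • a) →
        HasFDerivAt (fun y => f (y + t • a) - f y) (fderiv ℝ f (q + t • a) - fderiv ℝ f q) q := by
      intro f q h1 h2
      have h3 := h2.hasFDerivAt.comp q ((hasFDerivAt_id q).add_const (t • a))
      exact h3.sub h1.hasFDerivAt
    have hs := hshift (hdiff p hp) (hdiff _ ht)
    have hV' : Convex ℝ (V ∩ (fun y => y + t • a) ⁻¹' V) :=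
      hV.inter (by simpa [add_comm] using hV.translate_preimage_right (t • a))
    have hVo' : IsOpen (V ∩ (fun y => y + t • a) ⁻¹' V) := hVo.inter (hVo.preimage (by fun_prop))
    have := abs_fderiv_le_of_approx (w := fun y => w (y + t • a) - w y) (e := b) (N := N * |t|)
      hV' hVo' (by positivity) (fun ε hε => ?_) ⟨hp, ht⟩ hs.differentiableAt
    · rw [hs.fderiv] at this
      exact this
    · obtain ⟨v, hv, hb⟩ := h (ε / (2 + |t|)) (by positivity)
      have h4 : ε / (2 + |t|) * (2 + |t|) = ε := div_mul_cancel₀ _ (by positivity)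
      have hvd : Differentiable ℝ v := hv.differentiable two_ne_zero
      have hvd2 : Differentiable ℝ (fderiv ℝ v) :=
        (hv.fderiv_right (m := 1) (by norm_num)).differentiable one_ne_zero
      refine ⟨fun y => v (y + t • a) - v y, fun q => (hshift (hvd q) (hvd _)).differentiableAt,
        fun q hq => ⟨?_, ?_⟩⟩
      · have h2 := (hb _ hq.1).1
        have h3 := (hb _ hq.2).1
        have : 0 ≤ ε / (2 + |t|) * |t| := by positivity
        simp only
        rw [abs_le] at *
        constructor <;> linarith
      · rw [(hshift (hvd q) (hvd _)).fderiv]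
        have := abs_sub_le_of_abs_fderiv_le hV (v := fun y => fderiv ℝ v y b)
          (fun q => (happ (hvd2 q)).differentiableAt) (e := a) (N := N + ε / (2 + |t|))
          (fun q hq => by rw [(happ (hvd2 q)).fderiv]; exact (hb q hq).2) hq.1 hq.2
        simp only [_root_.sub_apply]
        have h5 : 0 ≤ ε / (2 + |t|) := by positivity
        linarith
  rw [(happ hdw).fderiv] at key
  exact key

end Approximation

lemma norm_iteratedFDeriv_two {G W : Type*} [NormedAddCommGroup G] [NormedSpace ℝ G]
    [NormedAddCommGroup W] [NormedSpace ℝ W] (f : G → W) (p : G) :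
    ‖iteratedFDeriv ℝ 2 f p‖ = ‖fderiv ℝ (fderiv ℝ f) p‖ := by
  rw [← norm_iteratedFDeriv_fderiv (n := 1), norm_iteratedFDeriv_one]

lemma norm_cvec_le (a : Option (Fin 3)) : ‖cvec a‖ ≤ 1 := by
  cases a <;> simp [cvec, tvec, xvec, basis3]

lemma abs_coord_le (a : Option (Fin 3)) (v : E3 × ℝ) : |coord a v| ≤ ‖v‖ := by
  cases a with
  | none => exact norm_snd_le v
  | some i => exact (PiLp.norm_apply_le v.1 i).trans (norm_fst_le v)

lemma opNorm_le_of_cvec {W : Type*} [NormedAddCommGroup W] [NormedSpace ℝ W]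
    (L : E3 × ℝ →L[ℝ] W) {N : ℝ} (hN : 0 ≤ N) (h : ∀ a, ‖L (cvec a)‖ ≤ N) : ‖L‖ ≤ 4 * N := by
  refine L.opNorm_le_bound (by positivity) fun v => ?_
  calc ‖L v‖ = ‖∑ a, coord a v • L (cvec a)‖ := by
        rw [← sum_coord_smul_cvec v, map_sum]
        simp only [map_smul, sum_coord_smul_cvec]
    _ ≤ ∑ _a : Option (Fin 3), ‖v‖ * N := norm_sum_le_of_le _ fun a _ => by
        rw [norm_smul]
        exact mul_le_mul (abs_coord_le a v) (h a) (norm_nonneg _) (norm_nonneg _)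
    _ = 4 * N * ‖v‖ := by
        simp only [Finset.sum_const, Finset.card_univ, Fintype.card_option, Fintype.card_fin]
        ring

lemma add_smul_tvec_mem_interior {r ρ η : ℝ} (hη : 0 < η) (hr : η < 2 * (ρ - r)) {p : E3 × ℝ}
    (hp : p ∈ Dcone r) : p + η • tvec ∈ interior (Dcone ρ) := by
  obtain ⟨-, h2, h3⟩ := hp
  rw [mem_interior_Dcone]
  simp only [tvec, Prod.fst_add, Prod.snd_add, Prod.smul_fst, Prod.smul_snd, smul_zero, add_zero,
    smul_eq_mul, mul_one]
  constructor <;> linarith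

lemma STPoly.fderiv_ev_cvec (P : STPoly) (a : Option (Fin 3)) (p : E3 × ℝ) :
    fderiv ℝ P.ev p (cvec a) = STPoly.ev (MvPolynomial.pderiv a P) p := by
  rw [STPoly.fderiv_ev]
  simp [-Fintype.sum_option, coord_cvec]

lemma STPoly.fderiv_fderiv_ev_cvec (P : STPoly) (a b : Option (Fin 3)) (p : E3 × ℝ) :
    fderiv ℝ (fderiv ℝ P.ev) p (cvec b) (cvec a) =
      STPoly.ev (MvPolynomial.pderiv b (MvPolynomial.pderiv a P)) p := by
  rw [STPoly.fderiv_fderiv_ev]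
  simp [-Fintype.sum_option, coord_cvec]

/-- The constant in the `C²` estimate for the Goursat problem with vanishing data. -/
def goursatConst (ρ : ℝ) : ℝ := 8 + 48 * ρ * (1 + 4 * ρ) + ρ ^ 2

lemma goursatConst_pos {ρ : ℝ} (hρ : 0 < ρ) : 0 < goursatConst ρ := by
  unfold goursatConst; positivity

lemma goursatConst_mono {r ρ : ℝ} (hr : 0 < r) (h : r ≤ ρ) : goursatConst r ≤ goursatConst ρ := by
  have := hr.trans_le h
  unfold goursatConst; gcongr

section goursat

variable {ρ N : ℝ} {w F : E3 × ℝ → ℝ}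

/-- A source term can be approximated by polynomials on smaller double cones. -/
lemma exists_source_approx (hF : ContDiffOn ℝ 2 F (interior (Dcone ρ)))
    (hFN : ∀ k ≤ 2, ∀ p ∈ interior (Dcone ρ), ‖iteratedFDeriv ℝ k F p‖ ≤ N)
    {r : ℝ} (hr : 0 < r) (hrρ : r < ρ) {ε : ℝ} (hε : 0 < ε) :
    ∃ P : STPoly, STPoly.BoundedOn (Dcone r) P (N + ε) ∧
      ∀ p ∈ interior (Dcone r), |F p - P.ev p| ≤ ε := by
  have hN : 0 ≤ N := (norm_nonneg _).trans (hFN 0 zero_le_two ((0 : E3), ρ)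
    (mem_interior_Dcone.2 (by simp; constructor <;> linarith)))
  obtain ⟨η, hη, hηr, hηN⟩ : ∃ η > 0, η < 2 * (ρ - r) ∧ N * η ≤ ε / 2 := by
    refine ⟨min (ρ - r) (ε / 2 / (N + 1)), lt_min (by linarith) (by positivity), ?_, ?_⟩
    · linarith [min_le_left (ρ - r) (ε / 2 / (N + 1))]
    · refine (mul_le_mul_of_nonneg_left (min_le_right _ _) hN).trans ?_
      rw [mul_div_assoc', div_le_iff₀ (by positivity)]
      nlinarith
  have hmem : ∀ p ∈ Dcone r, p + η • tvec ∈ interior (Dcone ρ) := fun p hp =>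
    add_smul_tvec_mem_interior hη hηr hp
  have hV : IsOpen ((fun p : E3 × ℝ => p + η • tvec) ⁻¹' interior (Dcone ρ)) :=
    isOpen_interior.preimage (by fun_prop)
  have hΦ : ContDiffOn ℝ 2 (fun p => F (p + η • tvec))
      ((fun p : E3 × ℝ => p + η • tvec) ⁻¹' interior (Dcone ρ)) :=
    hF.comp (ContDiff.contDiffOn (by fun_prop)) (mapsTo_preimage _ _)
  obtain ⟨P, hP⟩ := exists_ev_approx (isCompact_Dcone r) hV hmem hΦ (half_pos hε)
  have d1 : fderiv ℝ (fun p => F (p + η • tvec)) = fun p => fderiv ℝ F (p + η • tvec) :=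
    funext fun p => fderiv_comp_add_right _
  have d2 : ∀ p, fderiv ℝ (fun p => fderiv ℝ F (p + η • tvec)) p =
      fderiv ℝ (fderiv ℝ F) (p + η • tvec) := fun p => fderiv_comp_add_right _
  simp only [d1, d2] at hP
  have close : ∀ {x y : ℝ}, |x - y| ≤ ε / 2 → |y| ≤ N → |x| ≤ N + ε := by
    intro x y h1 h2
    rw [abs_le] at *
    constructor <;> linarith
  refine ⟨P, ⟨fun p hp => ?_, fun a p hp => ?_, fun a b p hp => ?_⟩, fun p hp => ?_⟩
  · refine close (hP p hp).1 ?_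
    simpa using hFN 0 zero_le_two _ (hmem p hp)
  · refine close ((hP p hp).2.1 a) ?_
    have h1 := hFN 1 one_le_two _ (hmem p hp)
    rw [norm_iteratedFDeriv_one] at h1
    exact ((fderiv ℝ F (p + η • tvec)).le_of_opNorm_le_of_le h1 (norm_cvec_le a)).trans_eq
      (mul_one N)
  · refine close ((hP p hp).2.2 a b) ?_
    have h1 := hFN 2 le_rfl _ (hmem p hp)
    rw [norm_iteratedFDeriv_two] at h1
    have h2 := ((fderiv ℝ (fderiv ℝ F) (p + η • tvec)).le_of_opNorm_le_of_le h1
      (norm_cvec_le b)).trans_eq (mul_one N)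
    exact (ContinuousLinearMap.le_of_opNorm_le_of_le _ h2 (norm_cvec_le a)).trans_eq (mul_one N)
  · have hp' := interior_subset hp
    have hpρ : p ∈ interior (Dcone ρ) := by
      rw [mem_interior_Dcone] at hp ⊢
      exact ⟨hp.1, by linarith [hp.2]⟩
    have h1 := ((convex_Dcone ρ).interior).norm_image_sub_le_of_norm_fderiv_le (𝕜 := ℝ) (f := F)
      (C := N) (fun q hq => (hF.contDiffAt (isOpen_interior.mem_nhds hq)).differentiableAt
        two_ne_zero) (fun q hq => by
        rw [← norm_iteratedFDeriv_one]; exact hFN 1 one_le_two q hq) hpρ (hmem p hp')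
    have h2 : ‖p + η • tvec - p‖ = η := by
      rw [add_sub_cancel_left, norm_smul, norm_of_nonneg hη.le]
      simp [tvec]
    rw [h2, norm_eq_abs] at h1
    have h3 := (hP p hp').1
    rw [abs_le] at *
    constructor <;> linarith

lemma exists_solution_approx (hw : ContDiffOn ℝ 2 w (Dcone ρ))
    (hw0 : ∀ x : E3, ‖x‖ ≤ ρ → w (x, ‖x‖) = 0)
    (hF : ContDiffOn ℝ 2 F (interior (Dcone ρ)))
    (hFN : ∀ k ≤ 2, ∀ p ∈ interior (Dcone ρ), ‖iteratedFDeriv ℝ k F p‖ ≤ N)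
    (hwF : ∀ p ∈ interior (Dcone ρ), wave w p = F p)
    {r : ℝ} (hr : 0 < r) (hrρ : r < ρ) {ε : ℝ} (hε : 0 < ε) :
    ∃ P : STPoly, STPoly.BoundedOn (interior (Dcone r)) P (goursatConst r * N + ε) ∧
      ∀ p ∈ interior (Dcone r), |w p - P.ev p| ≤ ε := by
  have hC := goursatConst_pos hr
  have hr2 : r ^ 2 ≤ goursatConst r := by
    unfold goursatConst
    have : 0 ≤ 48 * r * (1 + 4 * r) := by positivity
    linarith
  have hsub : Dcone r ⊆ Dcone ρ := fun p hp =>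
    ⟨hp.1.trans hrρ.le, hp.2.1, by linarith [hp.2.2]⟩
  obtain ⟨P, hPN, hPF⟩ := exists_source_approx hF hFN hr hrρ (ε := ε / goursatConst r)
    (by positivity)
  obtain ⟨Q, hQ⟩ := STPoly.exists_box_lor_mul_eq P
  have hCε : goursatConst r * (N + ε / goursatConst r) = goursatConst r * N + ε := by
    rw [mul_add, mul_div_cancel₀ _ hC.ne']
  refine ⟨STPoly.lor * Q, ?_, fun p hp => ?_⟩
  · rw [← hCε]
    exact STPoly.boundedOn_lor_mul hPN hQ hr
  · have hv : ContDiff ℝ 2 (STPoly.ev (STPoly.lor * Q)) := STPoly.contDiff_ev _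
    refine (abs_le_of_vanishing (A := ε / goursatConst r)
      ((hw.mono hsub).sub hv.contDiffOn) (fun x hx => ?_) (fun q hq => ?_) p hp).trans ?_
    · have hm : ((x, ‖x‖) : E3 × ℝ) ∈ lightCone r := ⟨rfl, hx⟩
      simp [hw0 x (hx.trans hrρ.le), STPoly.ev_lor_of_mem hm]
    · have hqρ : q ∈ interior (Dcone ρ) := interior_mono hsub hq
      rw [wave_sub isOpen_interior (hw.mono interior_subset) hv.contDiffOn hqρ, hwF q hqρ,
        STPoly.wave_ev, hQ]
      exact hPF q hq
    · rw [mul_div_assoc', div_le_iff₀ hC, mul_comm]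
      exact mul_le_mul_of_nonneg_left hr2 hε.le

/-- The `C²` estimate for the Goursat problem with vanishing data. -/
lemma norm_iteratedFDeriv_le_of_wave (hρ : 0 < ρ) (hw : ContDiffOn ℝ 2 w (Dcone ρ))
    (hw0 : ∀ x : E3, ‖x‖ ≤ ρ → w (x, ‖x‖) = 0)
    (hF : ContDiffOn ℝ 2 F (interior (Dcone ρ)))
    (hFN : ∀ k ≤ 2, ∀ p ∈ interior (Dcone ρ), ‖iteratedFDeriv ℝ k F p‖ ≤ N)
    (hwF : ∀ p ∈ interior (Dcone ρ), wave w p = F p) :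
    ∀ k ≤ 2, ∀ p ∈ interior (Dcone ρ), ‖iteratedFDeriv ℝ k w p‖ ≤ 16 * (goursatConst ρ * N) := by
  intro k hk p hp
  have hN : 0 ≤ N := (norm_nonneg _).trans (hFN 0 zero_le_two p hp)
  have hCN : 0 ≤ goursatConst ρ * N := mul_nonneg (goursatConst_pos hρ).le hN
  rw [mem_interior_Dcone] at hp
  obtain ⟨r, hr1, hrρ⟩ : ∃ r, (p.2 + ‖p.1‖) / 2 < r ∧ r < ρ := exists_between (by linarith [hp.2])
  have hr : 0 < r := by linarith [norm_nonneg p.1, hp.1]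
  have hpr : p ∈ interior (Dcone r) := mem_interior_Dcone.2 ⟨hp.1, by linarith⟩
  have happ : ∀ ε > 0, ∃ P : STPoly,
      STPoly.BoundedOn (interior (Dcone r)) P (goursatConst ρ * N + ε) ∧
      ∀ p ∈ interior (Dcone r), |w p - P.ev p| ≤ ε := by
    intro ε hε
    obtain ⟨P, hP, hPw⟩ := exists_solution_approx hw hw0 hF hFN hwF hr hrρ hε
    have hle : goursatConst r * N + ε ≤ goursatConst ρ * N + ε := by
      have := mul_le_mul_of_nonneg_right (goursatConst_mono hr hrρ.le) hN
      linarith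
    exact ⟨P, ⟨fun p hp => (hP.zero p hp).trans hle, fun a p hp => (hP.one a p hp).trans hle,
      fun a b p hp => (hP.two a b p hp).trans hle⟩, hPw⟩
  have hwr : ContDiffOn ℝ 2 w (interior (Dcone r)) := hw.mono fun q hq => by
    have hq := interior_subset hq
    exact ⟨hq.1.trans hrρ.le, hq.2.1, by linarith [hq.2.2]⟩
  have hconv := (convex_Dcone r).interior
  interval_cases k
  · rw [norm_iteratedFDeriv_zero]
    refine le_of_forall_pos_le_add fun ε hε => ?_
    obtain ⟨P, hP, hPw⟩ := happ (ε / 2) (half_pos hε)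
    have h1 := hP.zero p hpr
    have h2 := hPw p hpr
    rw [norm_eq_abs]
    rw [abs_le] at *
    constructor <;> linarith
  · rw [norm_iteratedFDeriv_one]
    refine (opNorm_le_of_cvec _ hCN fun a => ?_).trans (by linarith)
    refine abs_fderiv_le_of_approx hconv isOpen_interior hCN (fun ε hε => ?_) hpr
      ((hwr.contDiffAt (isOpen_interior.mem_nhds hpr)).differentiableAt two_ne_zero)
    obtain ⟨P, hP, hPw⟩ := happ ε hε
    refine ⟨P.ev, fun q => (STPoly.hasFDerivAt_ev P q).differentiableAt, fun q hq =>
      ⟨hPw q hq, ?_⟩⟩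
    rw [STPoly.fderiv_ev_cvec]
    exact hP.one a q hq
  · rw [norm_iteratedFDeriv_two]
    refine (opNorm_le_of_cvec _ (by positivity : 0 ≤ 4 * (goursatConst ρ * N)) fun b =>
      opNorm_le_of_cvec _ hCN fun a => ?_).trans (by linarith)
    refine abs_fderiv_fderiv_le_of_approx hconv isOpen_interior hwr hCN (fun ε hε => ?_) hpr
    obtain ⟨P, hP, hPw⟩ := happ ε hε
    refine ⟨P.ev, STPoly.contDiff_ev P, fun q hq => ⟨hPw q hq, ?_⟩⟩
    rw [STPoly.fderiv_fderiv_ev_cvec]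
    exact hP.two a b q hq

end goursat

section rayInt

variable {W : Type} [NormedAddCommGroup W] [NormedSpace ℝ W]

/-- The weighted average `∫₀¹ σᵐ φ(σx) dσ` along the segment from `0` to `x`. -/
def rayInt (m : ℕ) (φ : E3 → W) (x : E3) : W := ∫ σ in (0 : ℝ)..1, σ ^ m • φ (σ • x)

lemma continuous_rayInt (m : ℕ) {φ : E3 → W} (hφ : Continuous φ) : Continuous (rayInt m φ) :=
  intervalIntegral.continuous_parametric_intervalIntegral_of_continuous' (by fun_prop) 0 1

lemma hasFDerivAt_rayInt (m : ℕ) {φ : E3 → W} (hφ : ContDiff ℝ 1 φ) (x : E3) :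
    HasFDerivAt (rayInt m φ) (rayInt (m + 1) (fderiv ℝ φ) x) x := by
  have hc := hφ.continuous
  have hc' := hφ.continuous_fderiv one_ne_zero
  obtain ⟨C, hC⟩ := (isCompact_closedBall (0 : E3) (‖x‖ + 1)).exists_bound_of_continuousOn
    hc'.continuousOn
  refine intervalIntegral.hasFDerivAt_integral_of_dominated_of_fderiv_le (μ := volume)
    (F' := fun y σ => σ ^ (m + 1) • fderiv ℝ φ (σ • y)) (bound := fun _ => C)
    (ball_mem_nhds x one_pos) ?_ ?_ ?_ ?_ ?_ ?_
  · exact Filter.Eventually.of_forall fun y =>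
      (show Continuous fun σ : ℝ => σ ^ m • φ (σ • y) by fun_prop).aestronglyMeasurable
  · exact (show Continuous fun σ : ℝ => σ ^ m • φ (σ • x) by fun_prop).intervalIntegrable _ _
  · exact (show Continuous fun σ : ℝ => σ ^ (m + 1) • fderiv ℝ φ (σ • x) by
      fun_prop).aestronglyMeasurable
  · refine Filter.Eventually.of_forall fun σ hσ y hy => ?_
    rw [uIoc_of_le zero_le_one] at hσ
    have h1 : ‖σ • y‖ ≤ ‖x‖ + 1 := by
      rw [norm_smul, norm_of_nonneg hσ.1.le]
      have h2 : ‖y‖ ≤ ‖x‖ + 1 := by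
        have := norm_le_norm_add_norm_sub x y
        rw [mem_ball, dist_comm, dist_eq_norm] at hy
        linarith
      nlinarith [norm_nonneg y, hσ.1, hσ.2]
    rw [norm_smul, norm_pow, norm_of_nonneg hσ.1.le]
    refine (mul_le_of_le_one_left (norm_nonneg _) (pow_le_one₀ hσ.1.le hσ.2)).trans
      (hC _ (by simpa using h1))
  · exact intervalIntegrable_const
  · refine Filter.Eventually.of_forall fun σ _ y _ => ?_
    have h1 : HasFDerivAt (fun y : E3 => σ • y) (σ • ContinuousLinearMap.id ℝ E3) y :=
      (hasFDerivAt_id y).const_smul σ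
    have h2 := ((hφ.differentiable one_ne_zero (σ • y)).hasFDerivAt.comp y h1).const_smul (σ ^ m)
    refine h2.congr_fderiv ?_
    ext v
    simp [pow_succ, mul_smul]

lemma contDiff_rayInt (n : ℕ) : ∀ {W : Type} [NormedAddCommGroup W] [NormedSpace ℝ W] (m : ℕ)
    {φ : E3 → W}, ContDiff ℝ n φ → ContDiff ℝ n (rayInt m φ) := by
  induction n with
  | zero =>
    intro W _ _ m φ hφ
    exact contDiff_zero.2 (continuous_rayInt m hφ.continuous)
  | succ n ih =>
    intro W _ _ m φ hφ
    have h1 : ContDiff ℝ 1 φ := hφ.of_le (by norm_cast; omega)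
    have hd : fderiv ℝ (rayInt m φ) = rayInt (m + 1) (fderiv ℝ φ) :=
      funext fun x => (hasFDerivAt_rayInt m h1 x).fderiv
    push_cast
    rw [contDiff_succ_iff_fderiv]
    refine ⟨fun x => (hasFDerivAt_rayInt m h1 x).differentiableAt, by simp, ?_⟩
    rw [hd]
    exact ih (m + 1) (hφ.fderiv_right (by norm_cast))

lemma norm_iteratedFDeriv_rayInt_le (n : ℕ) : ∀ {W : Type} [NormedAddCommGroup W]
    [NormedSpace ℝ W] (m : ℕ) {φ : E3 → W}, ContDiff ℝ n φ → ∀ {x : E3} {N : ℝ},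
    (∀ σ ∈ Icc (0 : ℝ) 1, ‖iteratedFDeriv ℝ n φ (σ • x)‖ ≤ N) →
    ‖iteratedFDeriv ℝ n (rayInt m φ) x‖ ≤ N := by
  induction n with
  | zero =>
    intro W _ _ m φ hφ x N hN
    simp only [norm_iteratedFDeriv_zero] at hN ⊢
    have := intervalIntegral.norm_integral_le_of_norm_le_const (a := 0) (b := 1) (C := N)
      (f := fun σ : ℝ => σ ^ m • φ (σ • x)) fun σ hσ => by
        rw [uIoc_of_le zero_le_one] at hσ
        rw [norm_smul, norm_pow, norm_of_nonneg hσ.1.le]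
        exact (mul_le_of_le_one_left (norm_nonneg _) (pow_le_one₀ hσ.1.le hσ.2)).trans
          (hN σ (Ioc_subset_Icc_self hσ))
    simpa [rayInt] using this
  | succ n ih =>
    intro W _ _ m φ hφ x N hN
    have hd : fderiv ℝ (rayInt m φ) = rayInt (m + 1) (fderiv ℝ φ) :=
      funext fun x => (hasFDerivAt_rayInt m (hφ.of_le (by norm_cast; omega)) x).fderiv
    simp only [← norm_iteratedFDeriv_fderiv] at hN ⊢
    rw [hd]
    exact ih (m + 1) (hφ.fderiv_right (by norm_cast)) hN

end rayInt

lemma contDiff_pd {n : ℕ} {f : E3 → ℝ} (hf : ContDiff ℝ (n + 1 : ℕ) f) (i : Fin 3) :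
    ContDiff ℝ n (pd i f) :=
  (hf.fderiv_right (m := n) (by norm_cast)).clm_apply contDiff_const

lemma norm_iteratedFDeriv_pd_le {n : ℕ} {f : E3 → ℝ} (hf : ContDiff ℝ (n + 1 : ℕ) f) (i : Fin 3)
    (x : E3) : ‖iteratedFDeriv ℝ n (pd i f) x‖ ≤ ‖iteratedFDeriv ℝ (n + 1) f x‖ := by
  have h := norm_iteratedFDeriv_clm_apply_const (c := basis3 i) (x := x) (n := n) (N := n)
    (hf.fderiv_right (m := n) (by norm_cast)).contDiffAt le_rfl
  have hb : ‖basis3 i‖ = 1 := by simp [basis3]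
  rw [norm_iteratedFDeriv_fderiv, hb, one_mul] at h
  exact h

lemma contDiff_lap {n : ℕ} {f : E3 → ℝ} (hf : ContDiff ℝ (n + 2 : ℕ) f) :
    ContDiff ℝ n (lap f) :=
  ContDiff.sum fun i _ => contDiff_pd (contDiff_pd hf i) i

lemma norm_iteratedFDeriv_lap_le {n : ℕ} {f : E3 → ℝ} (hf : ContDiff ℝ (n + 2 : ℕ) f) (x : E3) :
    ‖iteratedFDeriv ℝ n (lap f) x‖ ≤ 3 * ‖iteratedFDeriv ℝ (n + 2) f x‖ := by
  have h1 : ∀ i, ContDiffAt ℝ n (pd i (pd i f)) x := fun i =>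
    (contDiff_pd (contDiff_pd hf i) i).contDiffAt
  have h2 : ∀ i, ‖iteratedFDeriv ℝ n (pd i (pd i f)) x‖ ≤ ‖iteratedFDeriv ℝ (n + 2) f x‖ :=
    fun i => (norm_iteratedFDeriv_pd_le (contDiff_pd hf i) i x).trans
      (norm_iteratedFDeriv_pd_le hf i x)
  have h3 : lap f = (pd 0 (pd 0 f) + pd 1 (pd 1 f)) + pd 2 (pd 2 f) := by
    ext y; simp [lap, Fin.sum_univ_three]
  rw [h3, iteratedFDeriv_add_apply (f := pd 0 (pd 0 f) + pd 1 (pd 1 f)) ((h1 0).add (h1 1)) (h1 2),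
    iteratedFDeriv_add_apply (h1 0) (h1 1)]
  refine (norm_add₃_le).trans ?_
  linarith [h2 0, h2 1, h2 2]

lemma norm_iteratedFDeriv_comp_fst_le {n : ℕ} {f : E3 → ℝ} (hf : ContDiff ℝ n f) (p : E3 × ℝ) :
    ‖iteratedFDeriv ℝ n (fun p : E3 × ℝ => f p.1) p‖ ≤ ‖iteratedFDeriv ℝ n f p.1‖ := by
  have h := (ContinuousLinearMap.fst ℝ E3 ℝ).iteratedFDeriv_comp_right hf p le_rfl
  change ‖iteratedFDeriv ℝ n (f ∘ ContinuousLinearMap.fst ℝ E3 ℝ) p‖ ≤ _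
  rw [h]
  refine (ContinuousMultilinearMap.norm_compContinuousLinearMap_le _ _).trans
    (mul_le_of_le_one_right (norm_nonneg _) ?_)
  exact Finset.prod_le_one (fun _ _ => norm_nonneg _)
    fun _ _ => ContinuousLinearMap.norm_fst_le ℝ E3 ℝ

lemma wave_eq {V : Set (E3 × ℝ)} (hV : IsOpen V) {u : E3 × ℝ → ℝ} (hu : ContDiffOn ℝ 2 u V)
    {p : E3 × ℝ} (hp : p ∈ V) : wave u p = pdt (pdt u) p - lapX u p := by
  have hd : DifferentiableAt ℝ (fderiv ℝ u) p :=
    ((hu.contDiffAt (hV.mem_nhds hp)).fderiv_right (m := 1) (by norm_num)).differentiableAt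
      one_ne_zero
  have happ : ∀ b, HasFDerivAt (fun y => fderiv ℝ u y b) ((fderiv ℝ (fderiv ℝ u) p).flip b) p := by
    intro b
    simpa using hd.hasFDerivAt.clm_apply (hasFDerivAt_const b p)
  have hslice : ∀ y, HasFDerivAt (fun y : E3 => ((y, p.2) : E3 × ℝ))
      ((ContinuousLinearMap.id ℝ E3).prod 0) y := fun y =>
    (hasFDerivAt_id y).prodMk (hasFDerivAt_const _ _)
  have ht : pdt (pdt u) p = fderiv ℝ (fderiv ℝ u) p tvec tvec := by
    change fderiv ℝ (fun y => fderiv ℝ u y tvec) p tvec = _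
    rw [(happ tvec).fderiv, ContinuousLinearMap.flip_apply]
  have hx : ∀ i, pd i (pd i (fixT u p.2)) p.1 =
      fderiv ℝ (fderiv ℝ u) p (xvec i) (xvec i) := by
    intro i
    have h1 : pd i (fixT u p.2) =ᶠ[nhds p.1] fun y => fderiv ℝ u (y, p.2) (xvec i) := by
      have : ∀ᶠ y in nhds p.1, (y, p.2) ∈ V :=
        (hslice p.1).continuousAt.eventually_mem (hV.mem_nhds hp)
      filter_upwards [this] with y hy
      have h2 := ((hu.contDiffAt (hV.mem_nhds hy)).differentiableAt two_ne_zero).hasFDerivAt.comp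
        y (hslice y)
      change fderiv ℝ (u ∘ fun y : E3 => ((y, p.2) : E3 × ℝ)) y (basis3 i) = _
      rw [h2.fderiv]
      simp [xvec]
    have h3 := (happ (xvec i)).comp p.1 (hslice p.1)
    have h4 : HasFDerivAt (pd i (fixT u p.2)) _ p.1 := h3.congr_of_eventuallyEq h1
    rw [pd, h4.fderiv]
    simp [xvec]
  simp only [wave, ht, lapX, lap, hx]

lemma wave_comp_fst {f : E3 → ℝ} (hf : ContDiff ℝ 2 f) (p : E3 × ℝ) :
    wave (fun p => f p.1) p = -lap f p.1 := by
  have h : pdt (fun p : E3 × ℝ => f p.1) = 0 := by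
    ext q
    have := ((hf.differentiable two_ne_zero q.1).hasFDerivAt.comp q hasFDerivAt_fst).fderiv
    change fderiv ℝ (f ∘ Prod.fst) q (0, 1) = 0
    rw [this]
    simp
  have hc : ContDiff ℝ 2 fun p : E3 × ℝ => f p.1 := hf.comp contDiff_fst
  rw [wave_eq isOpen_univ hc.contDiffOn (mem_univ p), h]
  have h0 : pdt (0 : E3 × ℝ → ℝ) p = 0 := by simp [pdt]
  rw [h0, zero_sub]
  rfl

lemma iteratedFDerivWithin_of_mem_nhds {G W : Type*} [NormedAddCommGroup G] [NormedSpace ℝ G]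
    [NormedAddCommGroup W] [NormedSpace ℝ W] (n : ℕ) (f : G → W) {s : Set G} {x : G}
    (h : s ∈ nhds x) : iteratedFDerivWithin ℝ n f s x = iteratedFDeriv ℝ n f x := by
  rw [← iteratedFDerivWithin_univ]
  exact iteratedFDerivWithin_congr_set (Filter.eventuallyEq_univ.2 h) n

lemma norm_iteratedFDeriv_mul_le_of_le {S : Set (E3 × ℝ)} (hS : IsOpen S) {f g : E3 × ℝ → ℝ}
    (hf : ContDiffOn ℝ 2 f S) (hg : ContDiffOn ℝ 2 g S) {a b : ℝ} {p : E3 × ℝ} (hp : p ∈ S)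
    (ha : ∀ k ≤ 2, ‖iteratedFDeriv ℝ k f p‖ ≤ a) (hb : ∀ k ≤ 2, ‖iteratedFDeriv ℝ k g p‖ ≤ b) :
    ∀ k ≤ 2, ‖iteratedFDeriv ℝ k (fun q => f q * g q) p‖ ≤ 4 * (a * b) := by
  intro k hk
  have ha0 : 0 ≤ a := (norm_nonneg _).trans (ha 0 zero_le_two)
  have hb0 : 0 ≤ b := (norm_nonneg _).trans (hb 0 zero_le_two)
  have h := norm_iteratedFDerivWithin_mul_le hf hg hS.uniqueDiffOn hp (n := k)
    (by exact_mod_cast hk)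
  simp only [iteratedFDerivWithin_of_isOpen _ hS hp] at h
  calc _ ≤ _ := h
    _ ≤ ∑ i ∈ Finset.range (k + 1), (k.choose i : ℝ) * (a * b) := by
        refine Finset.sum_le_sum fun i hi => ?_
        have hi := Finset.mem_range.1 hi
        rw [mul_assoc]
        exact mul_le_mul_of_nonneg_left
          (mul_le_mul (ha i (by omega)) (hb (k - i) (by omega)) (norm_nonneg _) ha0)
          (Nat.cast_nonneg _)
    _ = 2 ^ k * (a * b) := by
        rw [← Finset.sum_mul]
        congr 1
        exact_mod_cast Nat.sum_range_choose k
    _ ≤ 4 * (a * b) := by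
        refine mul_le_mul_of_nonneg_right ?_ (mul_nonneg ha0 hb0)
        calc (2 : ℝ) ^ k ≤ 2 ^ 2 := pow_le_pow_right₀ one_le_two hk
          _ = 4 := by norm_num

section solution

variable {ρ δ M : ℝ} {q : E3 → ℝ} {u : E3 × ℝ → ℝ}

lemma interior_Dcone_mono {r ρ : ℝ} (h : r ≤ ρ) : interior (Dcone r) ⊆ interior (Dcone ρ) :=
  interior_mono fun _ hp => ⟨hp.1.trans h, hp.2.1, by linarith [hp.2.2]⟩

lemma norm_iteratedFDeriv_le_of_isSolOn (hρ : 0 < ρ) (hq : ContDiffOn ℝ 8 q (closedBall (0 : E3) ρ))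
    (hδ : ∀ k : ℕ, k ≤ 8 → ∀ x ∈ closedBall (0 : E3) ρ,
      ‖iteratedFDerivWithin ℝ k q (closedBall (0 : E3) ρ) x‖ ≤ δ)
    (hu : IsSolOn ρ q u) (hM : ∀ k ≤ 2, ∀ p ∈ interior (Dcone ρ), ‖iteratedFDeriv ℝ k u p‖ ≤ M) :
    ∀ k ≤ 2, ∀ p ∈ interior (Dcone ρ),
      ‖iteratedFDeriv ℝ k u p‖ ≤ (64 * goursatConst ρ + 1) * (δ * (1 + M)) := by
  intro k hk p hp
  obtain ⟨huC, huW, huB⟩ := hu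
  have hδ0 : 0 ≤ δ := (norm_nonneg _).trans (hδ 0 (by norm_num) 0 (by simp [hρ.le]))
  have hM0 : 0 ≤ M := (norm_nonneg _).trans (hM 0 zero_le_two p hp)
  have hp' := mem_interior_Dcone.1 hp
  obtain ⟨r, hr1, hrρ⟩ : ∃ r, (p.2 + ‖p.1‖) / 2 < r ∧ r < ρ := exists_between (by linarith)
  have hr : 0 < r := by linarith [norm_nonneg p.1]
  have hpr : p ∈ interior (Dcone r) := mem_interior_Dcone.2 ⟨hp'.1, by linarith⟩
  have hsub : Dcone r ⊆ Dcone ρ := fun p hp =>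
    ⟨hp.1.trans hrρ.le, hp.2.1, by linarith [hp.2.2]⟩
  have hsubi := interior_Dcone_mono hrρ.le
  obtain ⟨f, hf, -, hfq⟩ := exists_contDiff_hasCompactSupport (n := 8)
    (isCompact_closedBall (0 : E3) r) isOpen_ball (closedBall_subset_ball hrρ)
    (hq.mono ball_subset_closedBall)
  have hfδ : ∀ k ≤ 8, ∀ x : E3, ‖x‖ ≤ r → ‖iteratedFDeriv ℝ k f x‖ ≤ δ := by
    intro k hk x hx
    have hx' : closedBall (0 : E3) ρ ∈ nhds x :=
      Filter.mem_of_superset (isOpen_ball.mem_nhds (by simpa using hx.trans_lt hrρ))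
        ball_subset_closedBall
    rw [((hfq x (by simpa using hx)).iteratedFDeriv ℝ k).self_of_nhds,
      ← iteratedFDerivWithin_of_mem_nhds k q hx']
    exact hδ k hk x (mem_of_mem_nhds hx')
  set g := rayInt 0 f with hg
  have hσ : ∀ x : E3, ‖x‖ ≤ r → ∀ σ ∈ Icc (0 : ℝ) 1, ‖σ • x‖ ≤ r := fun x hx σ hσ => by
    rw [norm_smul, norm_of_nonneg hσ.1]
    nlinarith [norm_nonneg x, hσ.1, hσ.2]
  have hf4 : ContDiff ℝ (4 : ℕ) f := hf.of_le (by norm_num)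
  have hg4 : ContDiff ℝ (4 : ℕ) g := contDiff_rayInt 4 0 hf4
  have hg2 : ContDiff ℝ 2 g := hg4.of_le (by norm_num)
  have hgδ : ∀ k ≤ 4, ∀ x : E3, ‖x‖ ≤ r → ‖iteratedFDeriv ℝ k g x‖ ≤ δ := fun k hk x hx =>
    norm_iteratedFDeriv_rayInt_le k 0 (hf4.of_le (by exact_mod_cast hk))
      fun σ hs => hfδ k (by omega) _ (hσ x hx σ hs)
  have hl2 : ContDiff ℝ (2 : ℕ) (lap g) := contDiff_lap hg4
  have hfst : ∀ {p : E3 × ℝ}, p ∈ interior (Dcone r) → ‖p.1‖ ≤ r := fun hp =>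
    (interior_subset hp).1
  have hui : ContDiffOn ℝ 2 u (interior (Dcone ρ)) := huC.mono interior_subset
  have hf1 : ContDiff ℝ 2 fun p : E3 × ℝ => f p.1 :=
    (hf.of_le (by norm_num)).comp contDiff_fst
  have hl1 : ContDiff ℝ 2 fun p : E3 × ℝ => lap g p.1 :=
    hl2.comp (f := Prod.fst) contDiff_fst
  have hg1 : ContDiff ℝ 2 fun p : E3 × ℝ => g p.1 := hg2.comp contDiff_fst
  have hw := norm_iteratedFDeriv_le_of_wave (w := fun p => u p - g p.1)
    (F := fun p => f p.1 * u p + lap g p.1) (N := 4 * (δ * M) + 3 * δ) hr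
    ((huC.mono hsub).sub hg1.contDiffOn) (fun x hx => ?_)
    ((hf1.contDiffOn.mul (hui.mono hsubi)).add hl1.contDiffOn) (fun k hk p hp => ?_)
    (fun p hp => ?_) k hk p hpr
  · have hw' : ContDiffAt ℝ k (fun p => u p - g p.1) p :=
      ((hui.contDiffAt (isOpen_interior.mem_nhds hp)).sub hg1.contDiffAt).of_le
        (by exact_mod_cast hk)
    have hg' : ContDiffAt ℝ k (fun p : E3 × ℝ => g p.1) p :=
      hg1.contDiffAt.of_le (by exact_mod_cast hk)
    have he : u = (fun p => u p - g p.1) + fun p => g p.1 := by ext; simp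
    rw [he, iteratedFDeriv_add_apply hw' hg']
    have h1 := (norm_iteratedFDeriv_comp_fst_le (n := k) (hg2.of_le (by exact_mod_cast hk)) p).trans
      (hgδ k (by omega) p.1 (hfst hpr))
    refine (norm_add_le_of_le hw h1).trans ?_
    have hC := goursatConst_mono hr hrρ.le
    have hC0 := goursatConst_pos hr
    have h2 : 4 * (δ * M) + 3 * δ ≤ 4 * (δ * (1 + M)) := by linarith
    have h3 := mul_le_mul hC h2 (by positivity) (hC0.le.trans hC)
    have h4 : δ ≤ δ * (1 + M) := by nlinarith
    linarith
  · rw [huB x (hx.trans hrρ.le), hg, rayInt, sub_eq_zero]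
    refine intervalIntegral.integral_congr fun σ hs => ?_
    rw [uIcc_of_le zero_le_one] at hs
    simp only [pow_zero, one_smul]
    exact (hfq _ (by simpa using hσ x hx σ hs)).self_of_nhds.symm
  · have hk2 : (k : WithTop ℕ∞) ≤ 2 := by exact_mod_cast hk
    have h1 := norm_iteratedFDeriv_mul_le_of_le isOpen_interior hf1.contDiffOn hui
      (hsubi hp) (fun k hk => (norm_iteratedFDeriv_comp_fst_le
        (hf.of_le (by exact_mod_cast (show k ≤ 8 by omega))) p).trans
        (hfδ k (by omega) p.1 (hfst hp))) (fun k hk => hM k hk p (hsubi hp)) k hk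
    have h2 := (norm_iteratedFDeriv_comp_fst_le (n := k)
      (hl2.of_le (by exact_mod_cast hk)) p).trans
      (norm_iteratedFDeriv_lap_le (hg4.of_le (by exact_mod_cast (show k + 2 ≤ 4 by omega))) p.1)
    have h3 := hgδ (k + 2) (by omega) p.1 (hfst hp)
    have e := iteratedFDeriv_add_apply (𝕜 := ℝ) (i := k) (x := p)
      (f := fun p : E3 × ℝ => f p.1 * u p) (g := fun p : E3 × ℝ => lap g p.1)
      ((hf1.contDiffAt.mul (hui.contDiffAt (isOpen_interior.mem_nhds (hsubi hp)))).of_le hk2)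
      (hl1.contDiffAt.of_le hk2)
    change ‖iteratedFDeriv ℝ k ((fun p : E3 × ℝ => f p.1 * u p) + fun p => lap g p.1) p‖ ≤ _
    rw [e]
    refine (norm_add_le_of_le h1 h2).trans ?_
    linarith
  · have h1 := huW p (hsubi hp)
    rw [wave_sub isOpen_interior hui hg1.contDiffOn (hsubi hp), wave_comp_fst hg2,
      wave_eq isOpen_interior hui (hsubi hp),
      (hfq p.1 (by simpa using hfst hp)).self_of_nhds]
    linarith

end solution

/-- The C² norm of the solution of the Goursat problem on `D_ρ` tends
to zero as the C⁸ norm of `q` tends to zero. -/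
theorem stmt1 (ρ : ℝ) (hρ : 0 < ρ) :
    ∀ ε > (0:ℝ), ∃ δ > (0:ℝ), ∀ q : E3 → ℝ,
      ContDiffOn ℝ 8 q (closedBall (0:E3) ρ) →
      (∀ k : ℕ, k ≤ 8 → ∀ x ∈ closedBall (0:E3) ρ,
        ‖iteratedFDerivWithin ℝ k q (closedBall (0:E3) ρ) x‖ ≤ δ) →
      ∀ u : E3 × ℝ → ℝ, IsSolOn ρ q u →
        ∀ k : ℕ, k ≤ 2 → ∀ p ∈ Dcone ρ,
          ‖iteratedFDerivWithin ℝ k u (Dcone ρ) p‖ ≤ ε := by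
  intro ε hε
  have hC := goursatConst_pos hρ
  set K := 3 * (64 * goursatConst ρ + 1) with hK
  have hK0 : 0 < K := by positivity
  refine ⟨min (1 / (2 * K)) (ε / (2 * K)), by positivity, fun q hq hδ u hu => ?_⟩
  set δ := min (1 / (2 * K)) (ε / (2 * K))
  have hδ1 : K * δ ≤ 1 / 2 := by
    calc K * δ ≤ K * (1 / (2 * K)) := mul_le_mul_of_nonneg_left (min_le_left _ _) hK0.le
      _ = 1 / 2 := by field_simp
  have hδ2 : K * δ ≤ ε / 2 := by
    calc K * δ ≤ K * (ε / (2 * K)) := mul_le_mul_of_nonneg_left (min_le_right _ _) hK0.le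
      _ = ε / 2 := by field_simp
  set Θ : E3 × ℝ → ℝ := fun p =>
    ∑ k ∈ Finset.range 3, ‖iteratedFDerivWithin ℝ k u (Dcone ρ) p‖ with hΘ
  have hΘc : ContinuousOn Θ (Dcone ρ) := continuousOn_finsetSum _ fun k hk =>
    (hu.1.continuousOn_iteratedFDerivWithin
      (by exact_mod_cast Nat.lt_succ_iff.1 (Finset.mem_range.1 hk)) (uniqueDiffOn_Dcone hρ)).norm
  have hle : ∀ k ≤ 2, ∀ p, ‖iteratedFDerivWithin ℝ k u (Dcone ρ) p‖ ≤ Θ p := fun k hk p =>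
    Finset.single_le_sum (f := fun k => ‖iteratedFDerivWithin ℝ k u (Dcone ρ) p‖)
      (fun _ _ => norm_nonneg _) (Finset.mem_range.2 (Nat.lt_succ_of_le hk))
  obtain ⟨p₀, hp₀, hmax⟩ := (isCompact_Dcone ρ).exists_isMaxOn
    ((nonempty_interior_Dcone hρ).mono interior_subset) hΘc
  have heq : ∀ k, ∀ p ∈ interior (Dcone ρ),
      iteratedFDerivWithin ℝ k u (Dcone ρ) p = iteratedFDeriv ℝ k u p := fun k p hp =>
    iteratedFDerivWithin_of_mem_nhds k u (mem_interior_iff_mem_nhds.1 hp)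
  have hint := norm_iteratedFDeriv_le_of_isSolOn hρ hq hδ hu (M := Θ p₀) fun k hk p hp => by
    rw [← heq k p hp]
    exact (hle k hk p).trans (hmax (interior_subset hp))
  have hΘi : ∀ p ∈ interior (Dcone ρ), Θ p ≤ K * δ * (1 + Θ p₀) := by
    intro p hp
    have := Finset.sum_le_card_nsmul (Finset.range 3)
      (fun k => ‖iteratedFDerivWithin ℝ k u (Dcone ρ) p‖)
      ((64 * goursatConst ρ + 1) * (δ * (1 + Θ p₀))) fun k hk => by
        rw [heq k p hp]
        exact hint k (Nat.lt_succ_iff.1 (Finset.mem_range.1 hk)) p hp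
    refine this.trans_eq ?_
    rw [Finset.card_range, nsmul_eq_mul, hK]
    push_cast
    ring
  have hcl : closure (interior (Dcone ρ)) = Dcone ρ := by
    rw [(convex_Dcone ρ).closure_interior_eq_closure_of_nonempty_interior
      (nonempty_interior_Dcone hρ), (isClosed_Dcone ρ).closure_eq]
  have hΘ₀ : Θ p₀ ≤ K * δ * (1 + Θ p₀) :=
    le_on_closure hΘi (by rwa [hcl]) continuousOn_const (by rwa [hcl])
  have hΘ0 : 0 ≤ Θ p₀ := Finset.sum_nonneg fun _ _ => norm_nonneg _
  intro k hk p hp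
  refine ((hle k hk p).trans (hmax hp)).trans ?_
  nlinarith
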